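/- arXiv:1203.4132 — 2 statements merged into one kernel-verified Lean document; each statement's English description precedes it below -/
import Mathlib

section
/- Let s ∈ ℝ, let g_θ be log-admissible with associated functions a, b, and let r_x be the unique solution of a(r) = x. Then the Laplace transform of the total cycle count under the generalized Ewens measure satisfies 𝔼[exp(−s K_{0n})] = e^{s/2} (r_n / r_{e^s n})^n · exp(e^{−s} g_θ(r_{e^s n})) / exp(g_θ(r_n)) · (b(r_n)/b(r_{e^s n}))^{1/2} (1 + o(1)) as n → ∞, where the error term is uniform in s for s in any fixed compact set. -/
open Filter Set Asymptotics MeasureTheory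
open scoped Topology

noncomputable section

/-- `c_j(σ)`: the number of cycles of length `j` in the permutation `σ ∈ S_n`
(fixed points count as cycles of length 1). -/
def cycleCount (n j : ℕ) (σ : Equiv.Perm (Fin n)) : ℕ :=
  if j = 1 then n - σ.support.card else σ.cycleType.count j

/-- `K_{0n}(σ) = Σ_{j=1}^n c_j(σ)`: the total number of cycles of `σ`. -/
def numCycles (n : ℕ) (σ : Equiv.Perm (Fin n)) : ℕ :=
  (n - σ.support.card) + σ.cycleType.card

/-- The unnormalized generalized Ewens weight `∏_{j=1}^n θ_j^{c_j(σ)}`. -/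
def ewensWeight (θ : ℕ → ℝ) (n : ℕ) (σ : Equiv.Perm (Fin n)) : ℝ :=
  ∏ j ∈ Finset.Icc 1 n, θ j ^ cycleCount n j σ

/-- The normalization constant `h_n = (1/n!) Σ_σ ∏_j θ_j^{c_j(σ)}` of the
generalized Ewens measure (equivalently, the `n`-th coefficient of `exp g_θ`). -/
def ewensH (θ : ℕ → ℝ) (n : ℕ) : ℝ :=
  (n.factorial : ℝ)⁻¹ * ∑ σ : Equiv.Perm (Fin n), ewensWeight θ n σ

open scoped Classical in
/-- Probability of an event under the generalized Ewens measure
`ℙ(σ) = (1/(h_n n!)) ∏_j θ_j^{c_j(σ)}`. -/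
def ewensProb (θ : ℕ → ℝ) (n : ℕ) (p : Equiv.Perm (Fin n) → Prop) : ℝ :=
  (∑ σ ∈ Finset.univ.filter p, ewensWeight θ n σ) /
    ∑ σ : Equiv.Perm (Fin n), ewensWeight θ n σ

/-- Expectation under the generalized Ewens measure. -/
def ewensExpect (θ : ℕ → ℝ) (n : ℕ) (f : Equiv.Perm (Fin n) → ℝ) : ℝ :=
  (∑ σ : Equiv.Perm (Fin n), f σ * ewensWeight θ n σ) /
    ∑ σ : Equiv.Perm (Fin n), ewensWeight θ n σ

/-- The coefficient sequence of `g_θ(t) = Σ_{k≥1} (θ_k/k) t^k`. -/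
def thetaCoeff (θ : ℕ → ℝ) : ℕ → ℝ := fun k => if k = 0 then 0 else θ k / k

/-- `g_θ` as a function on the complex disc. -/
def gThetaC (θ : ℕ → ℝ) : ℂ → ℂ := fun z => ∑' k : ℕ, (thetaCoeff θ k : ℂ) * z ^ k

/-- `g_θ` as a real function. -/
def gThetaR (θ : ℕ → ℝ) : ℝ → ℝ := fun t => ∑' k : ℕ, thetaCoeff θ k * t ^ k

/-- The standard normal cumulative distribution function. -/
def stdNormalCDF (x : ℝ) : ℝ :=
  ∫ t in Set.Iic x, Real.exp (-t ^ 2 / 2) / Real.sqrt (2 * Real.pi)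

/-- `(K_{0n} - μ_n)/σ_n` converges in distribution to a standard normal random
variable, where `K_{0n}` is distributed according to the generalized Ewens
measure with weights `θ` (stated via pointwise convergence of the CDFs to the
continuous standard normal CDF). -/
def convergesToStdNormal (θ : ℕ → ℝ) (μ σ' : ℕ → ℝ) : Prop :=
  ∀ x : ℝ, Tendsto
    (fun n => ewensProb θ n fun σ => ((numCycles n σ : ℝ) - μ n) / σ' n ≤ x)
    atTop (𝓝 (stdNormalCDF x))

/-- `log`-admissibility of a power series `g` with coefficients `gc`, radius of
convergence `ρ`, and associated functions `a`, `b`, `δ` (Definition 2.1). -/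
structure IsLogAdmissible (g : ℂ → ℂ) (gc : ℕ → ℝ) (ρ : ℝ) (a b δ : ℝ → ℝ) : Prop where
  rho_pos : 0 < ρ
  coeff_nonneg : ∀ n, 0 ≤ gc n
  series : ∀ z : ℂ, ‖z‖ < ρ → HasSum (fun n => (gc n : ℂ) * z ^ n) (g z)
  radius : ∀ t : ℝ, ρ < t → ¬ Summable fun n => gc n * t ^ n
  a_nonneg : ∀ r ∈ Set.Ico (0 : ℝ) ρ, 0 ≤ a r
  b_nonneg : ∀ r ∈ Set.Ico (0 : ℝ) ρ, 0 ≤ b r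
  delta_pos : ∀ r ∈ Set.Ico (0 : ℝ) ρ, 0 < δ r
  /-- approximation: `g(re^{iφ}) = g(r) + iφa(r) - φ²b(r)/2 + R(r,φ)` with
  `R(r,φ) = o(φ³ δ(r)⁻³)` uniformly in `φ` as `r → ρ`. -/
  approx : ∃ ε : ℝ → ℝ, Tendsto ε (𝓝[<] ρ) (𝓝 0) ∧
    ∀ r ∈ Set.Ico (0 : ℝ) ρ, ∀ φ : ℝ, |φ| ≤ δ r →
      ‖g (r * Complex.exp (φ * Complex.I)) -
          (g r + φ * Complex.I * a r - (φ : ℂ) ^ 2 / 2 * b r)‖ ≤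
        ε r * |φ| ^ 3 * (δ r)⁻¹ ^ 3
  a_div : Tendsto a (𝓝[<] ρ) atTop
  b_div : Tendsto b (𝓝[<] ρ) atTop
  delta_lim : Tendsto δ (𝓝[<] ρ) (𝓝 0)
  width : ∀ ε : ℝ, 0 < ε →
    Tendsto (fun r => ε * δ r ^ 2 * b r - Real.log (b r)) (𝓝[<] ρ) atTop
  mono : ∀ r ∈ Set.Ico (0 : ℝ) ρ, ∀ φ : ℝ, δ r < |φ| → |φ| ≤ Real.pi →
    (g (r * Complex.exp (φ * Complex.I))).re ≤
      max (g (r * Complex.exp (δ r * Complex.I))).re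
        (g (r * Complex.exp (-δ r * Complex.I))).re

/-- The technical condition (*): `|r_x^{(k)}| x^k ≲ |r_x^{(k-1)}| x^{k-1}` for
all sufficiently large `x` and `2 ≤ k ≤ 4`. -/
def TechCond (r : ℝ → ℝ) : Prop :=
  ∃ C > 0, ∃ x₀ : ℝ, ∀ x ≥ x₀, ∀ k : ℕ, 2 ≤ k → k ≤ 4 →
    |iteratedDeriv k r x| * x ^ k ≤ C * |iteratedDeriv (k - 1) r x| * x ^ (k - 1)

/-- The weight `∏_j c_j^{m_j} / m_j!` of a multiset in which `j` has multiplicity `m_j`. -/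
def multisetWeight (c : ℕ → ℝ) (m : Multiset ℕ) : ℝ :=
  ∏ j ∈ m.toFinset, c j ^ m.count j / (m.count j).factorial

/-- The `n`-th coefficient of `exp (∑ c_j t^j)`, as a sum over the partitions of `n`. -/
def partitionSum (c : ℕ → ℝ) (n : ℕ) : ℝ :=
  ∑ p : n.Partition, multisetWeight c p.parts

lemma multisetWeight_eq_prod (c : ℕ → ℝ) {m : Multiset ℕ} {T : Finset ℕ} (h : m.toFinset ⊆ T) :
    multisetWeight c m = ∏ j ∈ T, c j ^ m.count j / (m.count j).factorial := by
  refine Finset.prod_subset h fun j _ hj => ?_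
  rw [Multiset.mem_toFinset] at hj
  simp [Multiset.count_eq_zero_of_notMem hj]

lemma count_mul_multisetWeight (c : ℕ → ℝ) {m : Multiset ℕ} {j : ℕ} (hj : j ∈ m) :
    (m.count j : ℝ) * multisetWeight c m = c j * multisetWeight c (m.erase j) := by
  have hj' : j ∈ m.toFinset := Multiset.mem_toFinset.2 hj
  rw [multisetWeight_eq_prod c (m := m.erase j) (T := m.toFinset)
    (Multiset.toFinset_subset.2 (Multiset.erase_subset _ _)), multisetWeight,
    ← Finset.mul_prod_erase _ _ hj', ← Finset.mul_prod_erase _ _ hj', ← mul_assoc, ← mul_assoc]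
  congr 1
  · obtain ⟨k, hk⟩ := Nat.exists_eq_succ_of_ne_zero (Multiset.count_ne_zero.2 hj)
    rw [Multiset.count_erase_self, hk, Nat.succ_sub_one, Nat.factorial_succ]
    have : (k.factorial : ℝ) ≠ 0 := by positivity
    push_cast
    field_simp
    exact pow_succ' _ _
  · refine Finset.prod_congr rfl fun i hi => ?_
    rw [Multiset.count_erase_of_ne (Finset.ne_of_mem_erase hi)]

lemma partition_toFinset_subset {n : ℕ} (p : n.Partition) :
    p.parts.toFinset ⊆ Finset.Icc 1 n := fun j hj => by
  rw [Multiset.mem_toFinset] at hj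
  exact Finset.mem_Icc.2 ⟨p.parts_pos hj, p.le_of_mem_parts hj⟩

lemma partitionSum_zero (c : ℕ → ℝ) : partitionSum c 0 = 1 := by
  simp [partitionSum, multisetWeight]

lemma partitionSum_recurrence (c : ℕ → ℝ) (n : ℕ) :
    (n : ℝ) * partitionSum c n =
      ∑ j ∈ Finset.Icc 1 n, (j : ℝ) * c j * partitionSum c (n - j) := by
  have h1 (p : n.Partition) : (n : ℝ) * multisetWeight c p.parts =
      ∑ j ∈ Finset.Icc 1 n, (j : ℝ) * (p.parts.count j * multisetWeight c p.parts) := by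
    have h2 : n = ∑ j ∈ Finset.Icc 1 n, p.parts.count j • j := by
      rw [← Finset.sum_multiset_count_of_subset _ _ (partition_toFinset_subset p), p.parts_sum]
    have h3 : (n : ℝ) = ∑ j ∈ Finset.Icc 1 n, (p.parts.count j : ℝ) * j := by
      conv_lhs => rw [h2]
      push_cast [smul_eq_mul]
      rfl
    conv_lhs => rw [h3, Finset.sum_mul]
    exact Finset.sum_congr rfl fun j _ => by ring
  rw [partitionSum, Finset.mul_sum, Finset.sum_congr rfl fun p _ => h1 p, Finset.sum_comm]
  refine Finset.sum_congr rfl fun j hj => ?_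
  rw [Finset.mem_Icc] at hj
  rw [← Finset.mul_sum, mul_assoc]
  congr 1
  rw [partitionSum, Finset.mul_sum]
  refine (Finset.sum_filter_of_ne (p := fun p : n.Partition => j ∈ p.parts) ?_).symm.trans ?_
  · intro p _ hp
    by_contra h
    simp [Multiset.count_eq_zero_of_notMem h] at hp
  · refine (Finset.sum_subtype (F := inferInstance) (p := fun p : n.Partition => j ∈ p.parts) _
      (by simp) _).trans ?_
    refine Fintype.sum_equiv (Nat.Partition.partitionWithPartEquiv hj.1 hj.2) _ _ fun p => ?_
    rw [Nat.Partition.partitionWithPartEquiv_apply_parts]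
    exact count_mul_multisetWeight c p.2

lemma partition_eq_of_filter_eq {n : ℕ} {p q : n.Partition}
    (h : p.parts.filter (2 ≤ ·) = q.parts.filter (2 ≤ ·)) : p = q := by
  have key (p : n.Partition) : p.parts = p.parts.filter (2 ≤ ·) +
      Multiset.replicate (n - (p.parts.filter (2 ≤ ·)).sum) 1 := by
    have h1 : p.parts.filter (fun j => ¬ 2 ≤ j) =
        Multiset.replicate (Multiset.card (p.parts.filter fun j => ¬ 2 ≤ j)) 1 := by
      refine Multiset.eq_replicate_card.2 fun j hj => ?_
      rw [Multiset.mem_filter] at hj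
      have := p.parts_pos hj.1
      omega
    have h2 := Multiset.filter_add_not (2 ≤ ·) p.parts
    have h3 := congrArg Multiset.sum h2
    rw [Multiset.sum_add, h1, Multiset.sum_replicate, p.parts_sum, smul_eq_mul, mul_one] at h3
    conv_lhs => rw [← h2, h1]
    congr 2
    omega
  ext1
  rw [key p, key q, h]

/-- Cauchy's formula for the number of permutations with given cycle structure. -/
lemma card_partition_eq_mul {α : Type*} [Fintype α] [DecidableEq α]
    (p : (Fintype.card α).Partition) :
    (Finset.univ.filter fun σ : Equiv.Perm α => σ.partition = p).card *
      ∏ j ∈ p.parts.toFinset, (j ^ p.parts.count j * (p.parts.count j).factorial) =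
        (Fintype.card α).factorial := by
  have h1 : (Finset.univ.filter fun σ : Equiv.Perm α => σ.partition = p) =
      Finset.univ.filter fun σ : Equiv.Perm α =>
        σ.cycleType = p.parts.filter (2 ≤ ·) := by
    refine Finset.filter_congr fun σ _ => ⟨fun h => ?_, fun h => ?_⟩
    · rw [← h, Equiv.Perm.filter_parts_partition_eq_cycleType]
    · refine partition_eq_of_filter_eq ?_
      rw [← h, Equiv.Perm.filter_parts_partition_eq_cycleType]
  have h4 : ∀ j ∈ p.parts.filter (fun j => ¬ 2 ≤ j), j = 1 := fun j hj => by
    rw [Multiset.mem_filter] at hj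
    have := p.parts_pos hj.1
    omega
  have h2 := Multiset.filter_add_not (2 ≤ ·) p.parts
  have hcount : p.parts.filter (fun j => ¬ 2 ≤ j) =
      Multiset.replicate (p.parts.count 1) 1 := by
    rw [Multiset.eq_replicate_card.2 h4, ← Multiset.count_eq_card.2 fun j hj => (h4 j hj).symm,
      Multiset.count_filter_of_pos (by norm_num)]
  have hsum : (p.parts.filter (2 ≤ ·)).sum + p.parts.count 1 = Fintype.card α := by
    have h3 := congrArg Multiset.sum h2
    rw [Multiset.sum_add, hcount, Multiset.sum_replicate, p.parts_sum, smul_eq_mul, mul_one] at h3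
    exact h3
  have hprod : (p.parts.filter (2 ≤ ·)).prod = p.parts.prod := by
    have h3 := congrArg Multiset.prod h2
    rw [Multiset.prod_add, hcount, Multiset.prod_replicate, one_pow, mul_one] at h3
    exact h3
  have h5 := Equiv.Perm.card_of_cycleType_mul_eq α (p.parts.filter (2 ≤ ·))
  rw [if_pos ⟨by omega, fun a ha => (Multiset.mem_filter.1 ha).2⟩, hprod, ← h1] at h5
  rw [← h5]
  congr 1
  rw [Finset.prod_mul_distrib, ← Finset.prod_multiset_count, mul_comm (Nat.factorial _),
    mul_assoc]
  congr 1
  have h6 : (p.parts.filter (2 ≤ ·)).toFinset = p.parts.toFinset.erase 1 := by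
    ext j
    simp only [Multiset.mem_toFinset, Multiset.mem_filter, Finset.mem_erase]
    refine ⟨fun h => ⟨by omega, h.1⟩, fun h => ⟨h.2, ?_⟩⟩
    have := p.parts_pos h.2
    omega
  have h7 : Fintype.card α - (p.parts.filter (2 ≤ ·)).sum = p.parts.count 1 := by omega
  rw [h6, h7]
  have h8 : ∏ j ∈ p.parts.toFinset.erase 1, ((p.parts.filter (2 ≤ ·)).count j).factorial =
      ∏ j ∈ p.parts.toFinset.erase 1, (p.parts.count j).factorial := by
    refine Finset.prod_congr rfl fun j hj => ?_
    rw [← h6, Multiset.mem_toFinset, Multiset.mem_filter] at hj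
    rw [Multiset.count_filter_of_pos hj.2]
  rw [h8]
  by_cases h : 1 ∈ p.parts
  · rw [Finset.mul_prod_erase _ (fun j => (p.parts.count j).factorial)
      (Multiset.mem_toFinset.2 h)]
  · rw [Multiset.count_eq_zero_of_notMem h, Nat.factorial_zero, one_mul,
      Finset.erase_eq_of_notMem (by simpa using h)]

lemma cycleCount_eq_count {n j : ℕ} (σ : Equiv.Perm (Fin n)) :
    cycleCount n j σ = σ.partition.parts.count j := by
  have h1 : (1 : ℕ) ∉ σ.cycleType := fun h =>
    absurd (Equiv.Perm.one_lt_of_mem_cycleType h) (lt_irrefl 1)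
  rw [cycleCount, Equiv.Perm.parts_partition, Multiset.count_add, Multiset.count_replicate,
    Fintype.card_fin]
  split_ifs with h h' h'
  · rw [h, Multiset.count_eq_zero_of_notMem h1, zero_add]
  · exact absurd h.symm h'
  · exact absurd h'.symm h
  · rfl

lemma toFinset_partition_subset {n : ℕ} (σ : Equiv.Perm (Fin n)) :
    σ.partition.parts.toFinset ⊆ Finset.Icc 1 n := by
  simpa using partition_toFinset_subset σ.partition

lemma numCycles_eq_sum {n : ℕ} (σ : Equiv.Perm (Fin n)) :
    numCycles n σ = ∑ j ∈ Finset.Icc 1 n, cycleCount n j σ := by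
  simp_rw [cycleCount_eq_count]
  rw [Multiset.sum_count_eq_card fun j hj =>
    toFinset_partition_subset σ (Multiset.mem_toFinset.2 hj)]
  simp [numCycles, Equiv.Perm.parts_partition, add_comm]

lemma pow_numCycles_mul_ewensWeight (l : ℝ) (θ : ℕ → ℝ) {n : ℕ} (σ : Equiv.Perm (Fin n)) :
    l ^ numCycles n σ * ewensWeight θ n σ = ewensWeight (fun j => l * θ j) n σ := by
  simp_rw [ewensWeight, mul_pow, Finset.prod_mul_distrib, Finset.prod_pow_eq_pow_sum,
    numCycles_eq_sum]

lemma sum_ewensWeight (θ : ℕ → ℝ) (n : ℕ) :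
    ∑ σ : Equiv.Perm (Fin n), ewensWeight θ n σ =
      n.factorial * partitionSum (fun j => θ j / j) n := by
  have h1 (σ : Equiv.Perm (Fin n)) : ewensWeight θ n σ =
      ∏ j ∈ σ.partition.parts.toFinset, θ j ^ σ.partition.parts.count j := by
    rw [ewensWeight]
    simp_rw [cycleCount_eq_count]
    refine (Finset.prod_subset (toFinset_partition_subset σ) fun j _ hj => ?_).symm
    rw [Multiset.mem_toFinset] at hj
    rw [Multiset.count_eq_zero_of_notMem hj, pow_zero]
  have h2 : partitionSum (fun j => θ j / j) n =
      partitionSum (fun j => θ j / j) (Fintype.card (Fin n)) := by rw [Fintype.card_fin]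
  have h3 : n.factorial = (Fintype.card (Fin n)).factorial := by rw [Fintype.card_fin]
  rw [h2, h3, partitionSum, Finset.mul_sum,
    ← Finset.sum_fiberwise (s := Finset.univ) (g := fun σ : Equiv.Perm (Fin n) => σ.partition)]
  refine Finset.sum_congr rfl fun p _ => ?_
  rw [Finset.sum_congr rfl (g := fun _ => ∏ j ∈ p.parts.toFinset, θ j ^ p.parts.count j)
    fun σ hσ => by rw [h1, (Finset.mem_filter.1 hσ).2], Finset.sum_const, nsmul_eq_mul,
    ← card_partition_eq_mul p, multisetWeight]
  push_cast
  rw [mul_assoc, ← Finset.prod_mul_distrib]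
  congr 1
  refine Finset.prod_congr rfl fun j hj => ?_
  have hj0 : (j : ℝ) ≠ 0 := by
    exact_mod_cast (p.parts_pos (Multiset.mem_toFinset.1 hj)).ne'
  rw [div_pow]
  have : ((p.parts.count j).factorial : ℝ) ≠ 0 := by positivity
  field_simp

lemma hasFPowerSeriesOnBall_of_hasSum {g : ℂ → ℂ} {c : ℕ → ℝ} {ρ : ℝ} (hρ : 0 < ρ)
    (hs : ∀ z : ℂ, ‖z‖ < ρ → HasSum (fun n => (c n : ℂ) * z ^ n) (g z)) :
    HasFPowerSeriesOnBall g
      (FormalMultilinearSeries.ofScalars ℂ (fun n => (c n : ℂ))) 0 (ENNReal.ofReal ρ) where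
  r_le := by
    refine ENNReal.le_of_forall_nnreal_lt fun x hx => ?_
    rw [← ENNReal.ofReal_coe_nnreal, ENNReal.ofReal_lt_ofReal_iff hρ] at hx
    refine FormalMultilinearSeries.le_radius_of_summable _ ?_
    have h := (hs (x : ℝ) (by simpa using hx)).summable.norm
    refine h.congr fun n => ?_
    simp
  r_pos := by simpa using hρ
  hasSum := fun {y} hy => by
    have hy' : ‖y‖ < ρ := by
      rw [Metric.mem_eball, edist_zero_right, ← ofReal_norm,
        ENNReal.ofReal_lt_ofReal_iff hρ] at hy
      exact hy
    simpa [FormalMultilinearSeries.ofScalars_apply_eq, mul_comm] using hs y hy'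

lemma differentiableOn_of_hasSum {g : ℂ → ℂ} {c : ℕ → ℝ} {ρ : ℝ} (hρ : 0 < ρ)
    (hs : ∀ z : ℂ, ‖z‖ < ρ → HasSum (fun n => (c n : ℂ) * z ^ n) (g z)) :
    DifferentiableOn ℂ g (Metric.ball 0 ρ) := by
  have h := (hasFPowerSeriesOnBall_of_hasSum hρ hs).differentiableOn
  rwa [Metric.eball_ofReal] at h

lemma iteratedDeriv_of_hasSum {g : ℂ → ℂ} {c : ℕ → ℝ} {ρ : ℝ} (hρ : 0 < ρ)
    (hs : ∀ z : ℂ, ‖z‖ < ρ → HasSum (fun n => (c n : ℂ) * z ^ n) (g z)) (n : ℕ) :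
    iteratedDeriv n g 0 = n.factorial * c n := by
  have h := (hasFPowerSeriesOnBall_of_hasSum hρ hs).factorial_smul 1 n
  rw [iteratedFDeriv_apply_eq_iteratedDeriv_mul_prod, Finset.prod_const_one, one_smul] at h
  rw [← h]
  simp

lemma iteratedDeriv_cexp_of_hasSum {g : ℂ → ℂ} {c : ℕ → ℝ} {ρ : ℝ} (hρ : 0 < ρ)
    (hs : ∀ z : ℂ, ‖z‖ < ρ → HasSum (fun n => (c n : ℂ) * z ^ n) (g z)) (hc : c 0 = 0)
    (n : ℕ) :
    iteratedDeriv n (fun z => Complex.exp (g z)) 0 = n.factorial * (partitionSum c n : ℂ) := by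
  have hd := differentiableOn_of_hasSum hρ hs
  have hg : AnalyticAt ℂ g 0 := hd.analyticAt (Metric.ball_mem_nhds 0 hρ)
  have hF : AnalyticAt ℂ (fun z => Complex.exp (g z)) 0 := hg.cexp
  have hderiv : deriv (fun z => Complex.exp (g z)) =ᶠ[𝓝 0]
      (deriv g * fun z => Complex.exp (g z)) := by
    filter_upwards [hg.eventually_analyticAt] with z hz
    rw [Pi.mul_apply, mul_comm]
    exact hz.differentiableAt.hasDerivAt.cexp.deriv
  induction n using Nat.strong_induction_on with
  | _ n ih =>
    cases n with
    | zero =>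
      have h0 := iteratedDeriv_of_hasSum hρ hs 0
      simp [hc] at h0
      simp [h0, partitionSum_zero]
    | succ n =>
      rw [iteratedDeriv_succ', hderiv.iteratedDeriv_eq,
        iteratedDeriv_mul hg.deriv.contDiffAt hF.contDiffAt]
      have hrec := partitionSum_recurrence c (n + 1)
      have hrec' : ((n : ℂ) + 1) * (partitionSum c (n + 1) : ℂ) =
          ∑ i ∈ Finset.range (n + 1), ((i : ℂ) + 1) * c (i + 1) * partitionSum c (n - i) := by
        rw [Finset.range_eq_Ico]
        rw [← Finset.Ico_add_one_right_eq_Icc,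
          ← Finset.sum_Ico_add' _ 0 (n + 1) 1] at hrec
        simp only [Nat.add_sub_add_right] at hrec
        exact_mod_cast congrArg (fun x : ℝ => (x : ℂ)) hrec
      rw [Nat.factorial_succ, Nat.cast_mul, mul_right_comm, Nat.cast_succ, hrec',
        Finset.sum_mul]
      refine Finset.sum_congr rfl fun i hi => ?_
      have hi' : i ≤ n := Nat.lt_succ_iff.1 (Finset.mem_range.1 hi)
      rw [← iteratedDeriv_succ', iteratedDeriv_of_hasSum hρ hs, ih (n - i) (by omega),
        ← Nat.choose_mul_factorial_mul_factorial hi', Nat.factorial_succ]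
      push_cast
      ring

/-- Cauchy's formula for the coefficients of `exp g`. -/
lemma integral_cexp_of_hasSum {g : ℂ → ℂ} {c : ℕ → ℝ} {ρ : ℝ} (hρ : 0 < ρ)
    (hs : ∀ z : ℂ, ‖z‖ < ρ → HasSum (fun n => (c n : ℂ) * z ^ n) (g z)) (hc : c 0 = 0)
    (n : ℕ) {r : ℝ} (hr0 : 0 < r) (hr : r < ρ) :
    ∫ φ in (-Real.pi)..Real.pi,
      Complex.exp (g (r * Complex.exp (φ * Complex.I)) - n * φ * Complex.I) =
        2 * Real.pi * (r ^ n * partitionSum c n) := by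
  have hd : DifferentiableOn ℂ (fun z => Complex.exp (g z)) (Metric.closedBall 0 r) :=
    ((differentiableOn_of_hasSum hρ hs).mono (Metric.closedBall_subset_ball hr)).cexp
  have h1 := hd.circleIntegral_one_div_sub_center_pow_smul hr0 n
  have hnf : (n.factorial : ℂ) ≠ 0 := by exact_mod_cast n.factorial_ne_zero
  have hrc : (r : ℂ) ≠ 0 := by exact_mod_cast hr0.ne'
  rw [iteratedDeriv_cexp_of_hasSum hρ hs hc, smul_eq_mul, ← mul_assoc, div_mul_cancel₀ _ hnf,
    circleIntegral] at h1
  set G : ℝ → ℂ := fun φ =>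
    Complex.exp (g (r * Complex.exp (φ * Complex.I)) - n * φ * Complex.I) with hG
  have h2 (φ : ℝ) : deriv (circleMap 0 r) φ • ((1 / (circleMap 0 r φ - 0) ^ (n + 1)) •
      Complex.exp (g (circleMap 0 r φ))) = Complex.I * ((r : ℂ) ^ n)⁻¹ * G φ := by
    rw [deriv_circleMap, hG]
    simp only [circleMap, zero_add, sub_zero, smul_eq_mul]
    rw [Complex.exp_sub, mul_assoc (n : ℂ), Complex.exp_nat_mul, pow_succ, mul_pow]
    have := Complex.exp_ne_zero (φ * Complex.I)
    field_simp
  simp_rw [h2] at h1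
  rw [intervalIntegral.integral_const_mul] at h1
  have hper : Function.Periodic G (2 * Real.pi) := fun φ => by
    simp only [hG]
    rw [Complex.exp_sub, Complex.exp_sub, mul_assoc (n : ℂ), mul_assoc (n : ℂ),
      Complex.exp_nat_mul, Complex.exp_nat_mul]
    have : Complex.exp (((φ + 2 * Real.pi : ℝ) : ℂ) * Complex.I) =
        Complex.exp (φ * Complex.I) := by
      push_cast
      rw [add_mul, Complex.exp_add, Complex.exp_two_pi_mul_I, mul_one]
    rw [this]
  have h3 := hper.intervalIntegral_add_eq (-Real.pi) 0
  rw [zero_add, show -Real.pi + 2 * Real.pi = Real.pi by ring] at h3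
  rw [h3]
  have hrn : ((r : ℂ) ^ n) ≠ 0 := pow_ne_zero _ hrc
  have h4 : (r : ℂ) ^ n * Complex.I⁻¹ * (Complex.I * ((r : ℂ) ^ n)⁻¹ *
      ∫ φ in (0 : ℝ)..2 * Real.pi, G φ) = ∫ φ in (0 : ℝ)..2 * Real.pi, G φ := by
    have := Complex.I_ne_zero
    field_simp
  rw [← h4, h1]
  have := Complex.I_ne_zero
  field_simp

lemma norm_saddle_integrand_sub_gaussian_le {u : ℝ → ℂ} {G A B D e l ν φ : ℝ} (hB : 0 < B)
    (hl : 0 < l) (he : 0 ≤ e) (hle : l * e ≤ 1) (hν : l * A = ν)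
    (hD : 0 < D)
    (hnear : |φ| ≤ D → ‖u φ - (G + φ * Complex.I * A - (φ : ℂ) ^ 2 / 2 * B)‖ ≤
      e * |φ| ^ 3 * D⁻¹ ^ 3)
    (hfar : D < |φ| → (u φ).re ≤ G - D ^ 2 / 2 * B + e) :
    ‖Complex.exp (l * u φ - l * G - ν * φ * Complex.I) -
        ((Real.exp (-(l * B / 2) * φ ^ 2) : ℝ) : ℂ)‖ ≤
      2 * (l * e) * Real.exp (-(l * B / 2) * φ ^ 2) +
        Real.exp (-(l * B * D ^ 2 / 2) + l * e) +
        Real.exp (-(l * B * D ^ 2 / 4)) * Real.exp (-(l * B / 4) * φ ^ 2) := by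
  rcases le_or_gt |φ| D with h | h
  · have h1 := hnear h
    set R : ℂ := u φ - (G + φ * Complex.I * A - (φ : ℂ) ^ 2 / 2 * B) with hR
    have hRe : ‖R‖ ≤ e := by
      refine h1.trans ?_
      have : |φ| ^ 3 * D⁻¹ ^ 3 ≤ 1 := by
        rw [← mul_pow]
        refine pow_le_one₀ (by positivity) ?_
        rw [← div_eq_mul_inv]
        exact (div_le_one hD).2 h
      rw [mul_assoc]
      exact mul_le_of_le_one_right he this
    have hlR : ‖(l : ℂ) * R‖ ≤ l * e := by
      rw [norm_mul, Complex.norm_real, Real.norm_of_nonneg hl.le]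
      gcongr
    have h2 : Complex.exp (l * u φ - l * G - ν * φ * Complex.I) =
        ((Real.exp (-(l * B / 2) * φ ^ 2) : ℝ) : ℂ) * Complex.exp (l * R) := by
      rw [Complex.ofReal_exp, ← Complex.exp_add, hR, ← hν]
      congr 1
      push_cast
      ring
    rw [h2, ← mul_sub_one, norm_mul, Complex.norm_real, Real.norm_of_nonneg (Real.exp_nonneg _)]
    have h3 : ‖Complex.exp (l * R) - 1‖ ≤ 2 * (l * e) :=
      (Complex.norm_exp_sub_one_le (hlR.trans hle)).trans (by gcongr)
    have h4 := mul_le_mul_of_nonneg_left h3 (Real.exp_nonneg (-(l * B / 2) * φ ^ 2))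
    have h5 := Real.exp_nonneg (-(l * B * D ^ 2 / 2) + l * e)
    have h6 := mul_nonneg (Real.exp_nonneg (-(l * B * D ^ 2 / 4)))
      (Real.exp_nonneg (-(l * B / 4) * φ ^ 2))
    linarith
  · have h1 : ‖Complex.exp (l * u φ - l * G - ν * φ * Complex.I)‖ ≤
        Real.exp (-(l * B * D ^ 2 / 2) + l * e) := by
      rw [Complex.norm_exp, Real.exp_le_exp]
      have := mul_le_mul_of_nonneg_left (hfar h) hl.le
      simp
      linarith
    have h2 : Real.exp (-(l * B / 2) * φ ^ 2) ≤
        Real.exp (-(l * B * D ^ 2 / 4)) * Real.exp (-(l * B / 4) * φ ^ 2) := by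
      rw [← Real.exp_add, Real.exp_le_exp]
      have h3 : D ^ 2 ≤ φ ^ 2 := by
        rw [← sq_abs φ]
        gcongr
      have := mul_le_mul_of_nonneg_left h3 (mul_pos hl hB).le
      linarith
    have h3 := norm_sub_le (Complex.exp (l * u φ - l * G - ν * φ * Complex.I))
      ((Real.exp (-(l * B / 2) * φ ^ 2) : ℝ) : ℂ)
    rw [Complex.norm_real, Real.norm_of_nonneg (Real.exp_nonneg _)] at h3
    have h4 : 0 ≤ 2 * (l * e) * Real.exp (-(l * B / 2) * φ ^ 2) := by positivity
    linarith

lemma norm_saddle_integral_sub_gaussian_le {u : ℝ → ℂ} (hu : Continuous u)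
    {G A B D e l ν : ℝ} (hB : 0 < B) (hl : 0 < l) (he : 0 ≤ e) (hle : l * e ≤ 1)
    (hν : l * A = ν) (hD : 0 < D) (hDπ : D ≤ Real.pi)
    (hnear : ∀ φ : ℝ, |φ| ≤ D → ‖u φ - (G + φ * Complex.I * A - (φ : ℂ) ^ 2 / 2 * B)‖ ≤
      e * |φ| ^ 3 * D⁻¹ ^ 3)
    (hfar : ∀ φ : ℝ, D < |φ| → |φ| ≤ Real.pi → (u φ).re ≤ G - D ^ 2 / 2 * B + e) :
    ‖(∫ φ in (-Real.pi)..Real.pi, Complex.exp (l * u φ - l * G - ν * φ * Complex.I)) -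
        ((√(Real.pi / (l * B / 2)) : ℝ) : ℂ)‖ ≤
      2 * (l * e) * √(Real.pi / (l * B / 2)) +
        2 * Real.pi * Real.exp (-(l * B * D ^ 2 / 2) + l * e) +
        Real.exp (-(l * B * D ^ 2 / 4)) * √(Real.pi / (l * B / 4)) := by
  have hπ := Real.pi_pos
  have hk2 : 0 < l * B / 2 := by positivity
  have hk4 : 0 < l * B / 4 := by positivity
  set F : ℝ → ℂ := fun φ => Complex.exp (l * u φ - l * G - ν * φ * Complex.I) with hF
  have hFc : Continuous F := by fun_prop
  set S : Set ℝ := Set.Ioc (-Real.pi) Real.pi with hS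
  have hSm : MeasurableSet S := measurableSet_Ioc
  have hi2 := integrable_exp_neg_mul_sq hk2
  have hi4 := integrable_exp_neg_mul_sq hk4
  have hiF : Integrable (S.indicator F) := by
    rw [integrable_indicator_iff hSm]
    exact (hFc.integrableOn_Icc).mono_set Set.Ioc_subset_Icc_self
  have hiC : Integrable (S.indicator
      fun _ : ℝ => Real.exp (-(l * B * D ^ 2 / 2) + l * e)) := by
    rw [integrable_indicator_iff hSm]
    exact integrableOn_const (by simp [hS])
  rw [intervalIntegral.integral_of_le (by linarith), ← integral_indicator hSm,
    ← integral_gaussian, ← integral_complex_ofReal]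
  refine (congrArg norm (integral_sub hiF hi2.ofReal).symm).trans_le ?_
  have hbound : ∀ φ : ℝ, ‖S.indicator F φ - ((Real.exp (-(l * B / 2) * φ ^ 2) : ℝ) : ℂ)‖ ≤
      2 * (l * e) * Real.exp (-(l * B / 2) * φ ^ 2) +
        S.indicator (fun _ : ℝ => Real.exp (-(l * B * D ^ 2 / 2) + l * e)) φ +
        Real.exp (-(l * B * D ^ 2 / 4)) * Real.exp (-(l * B / 4) * φ ^ 2) := by
    intro φ
    by_cases h : φ ∈ S
    · rw [Set.indicator_of_mem h, Set.indicator_of_mem h]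
      have hφ : |φ| ≤ Real.pi := abs_le.2 ⟨h.1.le, h.2⟩
      exact norm_saddle_integrand_sub_gaussian_le hB hl he hle hν hD (hnear φ)
        fun h' => hfar φ h' hφ
    · rw [Set.indicator_of_notMem h, Set.indicator_of_notMem h, zero_sub, norm_neg,
        Complex.norm_real, Real.norm_of_nonneg (Real.exp_nonneg _), add_zero]
      have hφ : Real.pi ≤ |φ| := by
        by_contra h'
        rw [not_le, abs_lt] at h'
        exact h ⟨h'.1, h'.2.le⟩
      have h2 : Real.exp (-(l * B / 2) * φ ^ 2) ≤
          Real.exp (-(l * B * D ^ 2 / 4)) * Real.exp (-(l * B / 4) * φ ^ 2) := by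
        rw [← Real.exp_add, Real.exp_le_exp]
        have h3 : D ^ 2 ≤ φ ^ 2 := by
          rw [← sq_abs φ]
          gcongr
          exact hDπ.trans hφ
        have := mul_le_mul_of_nonneg_left h3 (mul_pos hl hB).le
        linarith
      have h4 : 0 ≤ 2 * (l * e) * Real.exp (-(l * B / 2) * φ ^ 2) := by positivity
      linarith
  refine (norm_integral_le_of_norm_le (((hi2.const_mul _).add hiC).add (hi4.const_mul _))
    (ae_of_all _ hbound)).trans_eq ?_
  have e1 := integral_add ((hi2.const_mul (2 * (l * e))).add hiC)
    (hi4.const_mul (Real.exp (-(l * B * D ^ 2 / 4))))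
  have e2 := integral_add (hi2.const_mul (2 * (l * e))) hiC
  simp only [Pi.add_apply] at e1 ⊢
  rw [e1, e2, integral_const_mul, integral_const_mul, integral_gaussian, integral_gaussian,
    integral_indicator hSm, setIntegral_const, hS, Real.volume_real_Ioc_of_le (by linarith),
    smul_eq_mul]
  ring

lemma gThetaC_ofReal (θ : ℕ → ℝ) (t : ℝ) : gThetaC θ t = (gThetaR θ t : ℂ) := by
  rw [gThetaC, gThetaR, Complex.ofReal_tsum]
  push_cast
  rfl

lemma norm_ofReal_mul_exp_lt {r ρ : ℝ} (hr0 : 0 ≤ r) (hr : r < ρ) (φ : ℝ) :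
    ‖(r : ℂ) * Complex.exp (φ * Complex.I)‖ < ρ := by
  rwa [norm_mul, Complex.norm_exp_ofReal_mul_I, mul_one, Complex.norm_real,
    Real.norm_of_nonneg hr0]

/-- Bound on the relative error of the saddle point approximation of the coefficients of
`exp (l g_θ)` at a radius where `a`, `b`, `δ` and the error function `ε` take the values
`A`, `B`, `D`, `e`, uniform in `l ∈ [e^{-M}, e^M]`. -/
def saddleErrorBound (M B D e : ℝ) : ℝ :=
  2 * (Real.exp M * e) +
    √(2 * Real.pi * Real.exp M) *
      Real.exp (-((Real.exp (-M) * D ^ 2 * B - Real.log B) / 2) + Real.exp M * e) +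
    √2 * Real.exp (-(Real.exp (-M) * D ^ 2 * B / 4))

lemma sqrt_mul_sqrt_gaussian {k : ℝ} (hk : 0 < k) :
    √(2 * Real.pi * k) * √(Real.pi / (k / 2)) = 2 * Real.pi := by
  have hπ := Real.pi_pos
  rw [← Real.sqrt_mul (by positivity), Real.sqrt_eq_iff_mul_self_eq (by positivity)
    (by positivity)]
  field_simp

lemma saddle_error_le {M B D e l : ℝ} (hB : 0 < B) (he : 0 ≤ e)
    (hl1 : Real.exp (-M) ≤ l) (hl2 : l ≤ Real.exp M) :
    √(2 * Real.pi * (l * B)) / (2 * Real.pi) *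
      (2 * (l * e) * √(Real.pi / (l * B / 2)) +
        2 * Real.pi * Real.exp (-(l * B * D ^ 2 / 2) + l * e) +
        Real.exp (-(l * B * D ^ 2 / 4)) * √(Real.pi / (l * B / 4))) ≤
      saddleErrorBound M B D e := by
  have hπ := Real.pi_pos
  have hl : 0 < l := (Real.exp_pos _).trans_le hl1
  have hk : 0 < l * B := mul_pos hl hB
  have hs1 := sqrt_mul_sqrt_gaussian hk
  have hs2 : √(2 * Real.pi * (l * B)) * √(Real.pi / (l * B / 4)) = 2 * Real.pi * √2 := by
    rw [← Real.sqrt_mul (by positivity), Real.sqrt_eq_iff_mul_self_eq (by positivity)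
      (by positivity), show 2 * Real.pi * √2 * (2 * Real.pi * √2) =
        4 * Real.pi ^ 2 * (√2 * √2) by ring, Real.mul_self_sqrt (by norm_num)]
    field_simp
  have hsB : √(2 * Real.pi * (l * B)) ≤
      √(2 * Real.pi * Real.exp M) * Real.exp (Real.log B / 2) := by
    rw [← Real.log_sqrt hB.le, Real.exp_log (Real.sqrt_pos.2 hB), ← Real.sqrt_mul (by positivity)]
    refine Real.sqrt_le_sqrt ?_
    rw [mul_assoc (2 * Real.pi)]
    gcongr
  have hBD : 0 ≤ D ^ 2 * B := by positivity
  have hexp : Real.exp (-M) * (D ^ 2 * B) ≤ l * (D ^ 2 * B) := by gcongr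
  have hle : l * e ≤ Real.exp M * e := by gcongr
  have t2 : √(2 * Real.pi * (l * B)) * Real.exp (-(l * B * D ^ 2 / 2) + l * e) ≤
      √(2 * Real.pi * Real.exp M) *
      Real.exp (-((Real.exp (-M) * D ^ 2 * B - Real.log B) / 2) + Real.exp M * e) := by
    calc _ ≤ √(2 * Real.pi * Real.exp M) * Real.exp (Real.log B / 2) *
          Real.exp (-(l * B * D ^ 2 / 2) + l * e) := by gcongr
      _ ≤ _ := by
        rw [mul_assoc, ← Real.exp_add]
        exact mul_le_mul_of_nonneg_left (Real.exp_le_exp.2 (by linarith)) (Real.sqrt_nonneg _)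
  have t3 : √2 * Real.exp (-(l * B * D ^ 2 / 4)) ≤
      √2 * Real.exp (-(Real.exp (-M) * D ^ 2 * B / 4)) := by
    gcongr √2 * Real.exp ?_
    linarith
  have hsplit : √(2 * Real.pi * (l * B)) / (2 * Real.pi) *
      (2 * (l * e) * √(Real.pi / (l * B / 2)) +
        2 * Real.pi * Real.exp (-(l * B * D ^ 2 / 2) + l * e) +
        Real.exp (-(l * B * D ^ 2 / 4)) * √(Real.pi / (l * B / 4))) =
      2 * (l * e) * (√(2 * Real.pi * (l * B)) * √(Real.pi / (l * B / 2)) / (2 * Real.pi)) +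
        √(2 * Real.pi * (l * B)) * Real.exp (-(l * B * D ^ 2 / 2) + l * e) +
        Real.exp (-(l * B * D ^ 2 / 4)) *
          (√(2 * Real.pi * (l * B)) * √(Real.pi / (l * B / 4)) / (2 * Real.pi)) := by
    field_simp
  rw [hsplit, hs1, hs2, div_self (by positivity), mul_div_cancel_left₀ _ (by positivity),
    saddleErrorBound]
  linarith

section Saddle

variable {θ : ℕ → ℝ} {ρ : ℝ} {a b δ : ℝ → ℝ}

/-- Saddle point approximation of the `n`-th coefficient of `exp (l g_θ)` at the radius `r` with
`l a(r) = n`. -/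
lemma abs_partitionSum_saddle_sub_one_le
    (hadm : IsLogAdmissible (gThetaC θ) (thetaCoeff θ) ρ a b δ) {M l r e : ℝ} {n : ℕ}
    (hr0 : 0 < r) (hr : r < ρ) (hb : 0 < b r) (hδ : δ r ≤ Real.pi)
    (happ : ∀ φ : ℝ, |φ| ≤ δ r →
      ‖gThetaC θ (r * Complex.exp (φ * Complex.I)) -
          (gThetaC θ r + φ * Complex.I * a r - (φ : ℂ) ^ 2 / 2 * b r)‖ ≤
        e * |φ| ^ 3 * (δ r)⁻¹ ^ 3)
    (hl1 : Real.exp (-M) ≤ l) (hl2 : l ≤ Real.exp M) (hle : Real.exp M * e ≤ 1)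
    (hn : l * a r = n) :
    |partitionSum (fun j => l * thetaCoeff θ j) n *
        (r ^ n * Real.exp (-(l * gThetaR θ r)) * √(2 * Real.pi * (l * b r))) - 1| ≤
      saddleErrorBound M (b r) (δ r) e := by
  have hπ := Real.pi_pos
  have hmem : r ∈ Set.Ico (0 : ℝ) ρ := ⟨hr0.le, hr⟩
  have hl : 0 < l := (Real.exp_pos _).trans_le hl1
  have hD : 0 < δ r := hadm.delta_pos r hmem
  have hδ1 : |δ r| ^ 3 * (δ r)⁻¹ ^ 3 = 1 := by
    rw [abs_of_pos hD, ← mul_pow, mul_inv_cancel₀ hD.ne', one_pow]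
  have he : 0 ≤ e := by
    have := (norm_nonneg _).trans (happ (δ r) (abs_of_pos hD).le)
    rwa [mul_assoc, hδ1, mul_one] at this
  have hre (φ : ℝ) (h : |φ| = δ r) :
      (gThetaC θ (r * Complex.exp (φ * Complex.I))).re ≤
        gThetaR θ r - δ r ^ 2 / 2 * b r + e := by
    have h1 := (Complex.re_le_norm _).trans (happ φ h.le)
    have h2 : φ ^ 2 = δ r ^ 2 := by rw [← sq_abs, h]
    have h3 : gThetaC θ r + φ * Complex.I * a r - (φ : ℂ) ^ 2 / 2 * b r =
        ((gThetaR θ r - φ ^ 2 / 2 * b r : ℝ) : ℂ) + ((φ * a r : ℝ) : ℂ) * Complex.I := by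
      rw [gThetaC_ofReal]
      push_cast
      ring
    rw [h, mul_assoc e, ← mul_pow, mul_inv_cancel₀ hD.ne', one_pow, mul_one, h3, Complex.sub_re,
      Complex.add_re, Complex.ofReal_re, Complex.re_ofReal_mul, Complex.I_re, mul_zero, add_zero,
      h2] at h1
    linarith
  set u : ℝ → ℂ := fun φ => gThetaC θ (r * Complex.exp (φ * Complex.I)) with hu
  have huc : Continuous u := by
    have hd := differentiableOn_of_hasSum hadm.rho_pos hadm.series
    refine hd.continuousOn.comp_continuous (by fun_prop) fun φ => ?_
    rw [mem_ball_zero_iff]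
    exact norm_ofReal_mul_exp_lt hr0.le hr φ
  have hfar : ∀ φ : ℝ, δ r < |φ| → |φ| ≤ Real.pi →
      (u φ).re ≤ gThetaR θ r - δ r ^ 2 / 2 * b r + e := by
    intro φ h1 h2
    refine (hadm.mono r hmem φ h1 h2).trans (max_le (hre (δ r) (abs_of_pos hD)) ?_)
    have := hre (-δ r) (by rw [abs_neg, abs_of_pos hD])
    rwa [Complex.ofReal_neg] at this
  have hmain := norm_saddle_integral_sub_gaussian_le huc hb hl he
    ((mul_le_mul_of_nonneg_right hl2 he).trans hle) hn hD hδ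
    (fun φ h => by rw [← gThetaC_ofReal]; exact happ φ h) hfar
  have hser : ∀ z : ℂ, ‖z‖ < ρ → HasSum (fun n => ((l * thetaCoeff θ n : ℝ) : ℂ) * z ^ n)
      (l * gThetaC θ z) := fun z hz => by
    simpa [mul_assoc] using (hadm.series z hz).mul_left (l : ℂ)
  have hcauchy := integral_cexp_of_hasSum hadm.rho_pos hser (by simp [thetaCoeff]) n hr0 hr
  have hint : (∫ φ in (-Real.pi)..Real.pi,
      Complex.exp (l * u φ - l * gThetaR θ r - (n : ℝ) * φ * Complex.I)) =
      ((Real.exp (-(l * gThetaR θ r)) * (2 * Real.pi *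
        (r ^ n * partitionSum (fun j => l * thetaCoeff θ j) n)) : ℝ) : ℂ) := by
    push_cast
    rw [← hcauchy, ← intervalIntegral.integral_const_mul]
    congr 1 with φ
    rw [← Complex.exp_add]
    congr 1
    ring
  rw [hint, ← Complex.ofReal_sub, Complex.norm_real, Real.norm_eq_abs] at hmain
  have hk : 0 < l * b r := mul_pos hl hb
  have hs1 := sqrt_mul_sqrt_gaussian hk
  refine le_trans (le_of_eq ?_) ((mul_le_mul_of_nonneg_left hmain
    (by positivity : 0 ≤ √(2 * Real.pi * (l * b r)) / (2 * Real.pi))).trans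
    (saddle_error_le hb he hl1 hl2))
  rw [← abs_of_nonneg (by positivity : 0 ≤ √(2 * Real.pi * (l * b r)) / (2 * Real.pi)),
    ← abs_mul, mul_sub, div_mul_eq_mul_div _ _ √(Real.pi / (l * b r / 2)), hs1,
    div_self (by positivity)]
  congr 2
  field_simp

lemma tendsto_saddleErrorBound (hadm : IsLogAdmissible (gThetaC θ) (thetaCoeff θ) ρ a b δ)
    (M : ℝ) {e : ℝ → ℝ} (he : Tendsto e (𝓝[<] ρ) (𝓝 0)) :
    Tendsto (fun r => saddleErrorBound M (b r) (δ r) (e r)) (𝓝[<] ρ) (𝓝 0) := by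
  have hw := hadm.width (Real.exp (-M)) (Real.exp_pos _)
  have hlog := Real.tendsto_log_atTop.comp hadm.b_div
  have hw' : Tendsto (fun r => Real.exp (-M) * δ r ^ 2 * b r) (𝓝[<] ρ) atTop :=
    (hw.atTop_add_atTop hlog).congr fun r => by simp
  have he' : Tendsto (fun r => Real.exp M * e r) (𝓝[<] ρ) (𝓝 0) := by
    simpa using he.const_mul (Real.exp M)
  have h2 : Tendsto (fun r => Real.exp
      (-((Real.exp (-M) * δ r ^ 2 * b r - Real.log (b r)) / 2) + Real.exp M * e r))
      (𝓝[<] ρ) (𝓝 0) :=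
    Real.tendsto_exp_atBot.comp
      ((tendsto_neg_atTop_atBot.comp (hw.atTop_div_const two_pos)).atBot_add he')
  have h3 : Tendsto (fun r => Real.exp (-(Real.exp (-M) * δ r ^ 2 * b r / 4)))
      (𝓝[<] ρ) (𝓝 0) :=
    Real.tendsto_exp_neg_atTop_nhds_zero.comp (hw'.atTop_div_const four_pos)
  simpa [saddleErrorBound] using ((he'.const_mul 2).add
    (h2.const_mul √(2 * Real.pi * Real.exp M))).add (h3.const_mul √2)

/-- The saddle point approximation of the coefficients of `exp (l g_θ)` holds uniformly for
`l ∈ [e^{-M}, e^M]`. -/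
lemma eventually_abs_partitionSum_saddle_sub_one_le
    (hadm : IsLogAdmissible (gThetaC θ) (thetaCoeff θ) ρ a b δ) (M : ℝ) {η : ℝ} (hη : 0 < η) :
    ∀ᶠ r in 𝓝[<] ρ, 0 < r ∧ 0 < b r ∧ ∀ l, Real.exp (-M) ≤ l → l ≤ Real.exp M →
      ∀ n : ℕ, l * a r = n → |partitionSum (fun j => l * thetaCoeff θ j) n *
        (r ^ n * Real.exp (-(l * gThetaR θ r)) * √(2 * Real.pi * (l * b r))) - 1| ≤ η := by
  obtain ⟨e, he, happ⟩ := hadm.approx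
  have he' : Tendsto (fun r => Real.exp M * e r) (𝓝[<] ρ) (𝓝 0) := by
    simpa using he.const_mul (Real.exp M)
  filter_upwards [(tendsto_saddleErrorBound hadm M he).eventually_le_const hη,
    he'.eventually_le_const one_pos, hadm.delta_lim.eventually_le_const Real.pi_pos,
    hadm.b_div.eventually_gt_atTop 0, self_mem_nhdsWithin,
    mem_nhdsWithin_of_mem_nhds (lt_mem_nhds hadm.rho_pos)] with r h1 h2 h3 h4 h5 h6
  exact ⟨h6, h4, fun l hl1 hl2 n hn => (abs_partitionSum_saddle_sub_one_le hadm h6 h5 h4 h3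
    (happ r ⟨h6.le, h5⟩) hl1 hl2 h2 hn).trans h1⟩

/-- `a(r) = r g_θ'(r)`. -/
lemma IsLogAdmissible.a_eq (hadm : IsLogAdmissible (gThetaC θ) (thetaCoeff θ) ρ a b δ)
    {r : ℝ} (hr : r ∈ Set.Ico (0 : ℝ) ρ) : (a r : ℂ) = r * deriv (gThetaC θ) r := by
  obtain ⟨e, -, happ⟩ := hadm.approx
  have hd := differentiableOn_of_hasSum hadm.rho_pos hadm.series
  have hmem : (r : ℂ) ∈ Metric.ball (0 : ℂ) ρ := by
    rw [mem_ball_zero_iff, Complex.norm_real, Real.norm_of_nonneg hr.1]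
    exact hr.2
  have hg : HasDerivAt (gThetaC θ) (deriv (gThetaC θ) r) r :=
    (hd.differentiableAt (Metric.isOpen_ball.mem_nhds hmem)).hasDerivAt
  have h1 : HasDerivAt (fun φ : ℝ => (r : ℂ) * Complex.exp (φ * Complex.I))
      (r * Complex.I) 0 := by
    simpa using (((Complex.ofRealCLM.hasDerivAt (x := (0 : ℝ))).mul_const
      Complex.I).cexp.const_mul (r : ℂ))
  have h2 : HasDerivAt (fun φ : ℝ => gThetaC θ (r * Complex.exp (φ * Complex.I)))
      (deriv (gThetaC θ) r * (r * Complex.I)) 0 :=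
    HasDerivAt.comp (h₂ := gThetaC θ) (0 : ℝ) (by
      rwa [show (r : ℂ) * Complex.exp ((0 : ℝ) * Complex.I) = r by simp]) h1
  have h3 : HasDerivAt (fun φ : ℝ => gThetaC θ (r * Complex.exp (φ * Complex.I)))
      (Complex.I * a r) 0 := by
    rw [hasDerivAt_iff_isLittleO]
    have hD := hadm.delta_pos r hr
    have hlittle : (fun φ : ℝ => φ ^ 2 * (b r / 2 + |φ| * (e r * (δ r)⁻¹ ^ 3))) =o[𝓝 0]
        fun φ : ℝ => φ - 0 := by
      have hz : Tendsto (fun φ : ℝ => φ * (b r / 2 + |φ| * (e r * (δ r)⁻¹ ^ 3))) (𝓝 0) (𝓝 0) := by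
        have hc : Continuous fun φ : ℝ => φ * (b r / 2 + |φ| * (e r * (δ r)⁻¹ ^ 3)) := by
          fun_prop
        simpa using hc.tendsto 0
      refine ((Asymptotics.isLittleO_one_iff ℝ).2 hz |>.mul_isBigO
        (Asymptotics.isBigO_refl (fun φ : ℝ => φ) (𝓝 0))).congr (fun φ => by ring)
        fun φ => by simp
    refine Asymptotics.IsBigO.trans_isLittleO (Asymptotics.IsBigO.of_bound 1 ?_) hlittle
    have hnear : ∀ᶠ φ : ℝ in 𝓝 0, |φ| < δ r := by
      have := continuous_abs.tendsto (0 : ℝ)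
      rw [abs_zero] at this
      exact this.eventually_lt_const hD
    filter_upwards [hnear] with φ hφ
    have h := happ r hr φ hφ.le
    have hb := hadm.b_nonneg r hr
    have hq : ‖(φ : ℂ) ^ 2 / 2 * b r‖ = φ ^ 2 / 2 * b r := by
      rw [← Complex.ofReal_pow, ← Complex.ofReal_ofNat, ← Complex.ofReal_div,
        ← Complex.ofReal_mul, Complex.norm_real, Real.norm_of_nonneg (by positivity)]
    rw [one_mul]
    refine le_trans ?_ (Real.le_norm_self _)
    calc _ = ‖(gThetaC θ (r * Complex.exp (φ * Complex.I)) -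
          (gThetaC θ r + φ * Complex.I * a r - (φ : ℂ) ^ 2 / 2 * b r)) -
            (φ : ℂ) ^ 2 / 2 * b r‖ := by
          congr 1
          simp
          ring
      _ ≤ e r * |φ| ^ 3 * (δ r)⁻¹ ^ 3 + φ ^ 2 / 2 * b r :=
        (norm_sub_le _ _).trans (by rw [hq]; gcongr)
      _ = _ := by
        rw [pow_succ, sq_abs]
        ring
  have h4 := h2.unique h3
  refine mul_left_cancel₀ Complex.I_ne_zero ?_
  rw [← h4]
  ring

lemma IsLogAdmissible.exists_a_le (hadm : IsLogAdmissible (gThetaC θ) (thetaCoeff θ) ρ a b δ)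
    {t : ℝ} (ht : t < ρ) : ∃ C, ∀ r ∈ Set.Icc 0 t, a r ≤ C := by
  have hd := (differentiableOn_of_hasSum hadm.rho_pos hadm.series).deriv Metric.isOpen_ball
  have hc : ContinuousOn (fun r : ℝ => (r : ℂ) * deriv (gThetaC θ) r) (Set.Icc 0 t) := by
    refine Complex.continuous_ofReal.continuousOn.mul
      (hd.continuousOn.comp Complex.continuous_ofReal.continuousOn fun r hr => ?_)
    rw [mem_ball_zero_iff, Complex.norm_real, Real.norm_of_nonneg hr.1]
    exact hr.2.trans_lt ht
  obtain ⟨C, hC⟩ := isCompact_Icc.exists_bound_of_continuousOn hc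
  refine ⟨C, fun r hr => ?_⟩
  have h := hC r hr
  rw [← hadm.a_eq ⟨hr.1, hr.2.trans_lt ht⟩, Complex.norm_real] at h
  exact (Real.le_norm_self _).trans h

lemma IsLogAdmissible.tendsto_saddle
    (hadm : IsLogAdmissible (gThetaC θ) (thetaCoeff θ) ρ a b δ) {r : ℝ → ℝ}
    (hr : ∀ x > 0, r x ∈ Set.Ico 0 ρ ∧ a (r x) = x) : Tendsto r atTop (𝓝[<] ρ) := by
  have hlt : ∀ᶠ x in atTop, r x < ρ := by
    filter_upwards [eventually_gt_atTop 0] with x hx using (hr x hx).1.2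
  refine tendsto_nhdsWithin_iff.2 ⟨tendsto_order.2 ⟨fun t ht => ?_, fun t ht => ?_⟩, hlt⟩
  · obtain ⟨C, hC⟩ := hadm.exists_a_le ht
    filter_upwards [eventually_gt_atTop 0, eventually_gt_atTop C] with x hx hxC
    by_contra! h
    have := hC (r x) ⟨(hr x hx).1.1, h⟩
    rw [(hr x hx).2] at this
    exact this.not_gt hxC
  · exact hlt.mono fun x hx => hx.trans ht

end Saddle

lemma ewensExpect_exp_neg_mul_numCycles (θ : ℕ → ℝ) (n : ℕ) (s : ℝ) :
    ewensExpect θ n (fun σ => Real.exp (-s * (numCycles n σ : ℝ))) =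
      partitionSum (fun j => Real.exp (-s) * thetaCoeff θ j) n /
        partitionSum (fun j => 1 * thetaCoeff θ j) n := by
  have hc (l : ℝ) : (fun j : ℕ => l * θ j / j) = fun j => l * thetaCoeff θ j := by
    funext j
    rcases eq_or_ne j 0 with rfl | hj
    · simp [thetaCoeff]
    · simp [thetaCoeff, hj, mul_div_assoc]
  have hn : (n.factorial : ℝ) ≠ 0 := by positivity
  have hnum : ∑ σ, Real.exp (-s * (numCycles n σ : ℝ)) * ewensWeight θ n σ =
      ∑ σ, ewensWeight (fun j => Real.exp (-s) * θ j) n σ :=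
    Finset.sum_congr rfl fun σ _ => by
      rw [mul_comm (-s), Real.exp_nat_mul, pow_numCycles_mul_ewensWeight]
  have hden : (fun j : ℕ => θ j / j) = fun j => 1 * thetaCoeff θ j := by
    simpa using hc 1
  rw [ewensExpect, hnum, sum_ewensWeight, sum_ewensWeight, hc, hden,
    mul_div_mul_left _ _ hn]

lemma abs_div_sub_div_le {x y v w η : ℝ} (hv : 0 < v) (hw : 0 < w) (hη : η ≤ 1 / 2)
    (hx : |x * v - 1| ≤ η) (hy : |y * w - 1| ≤ η) :
    |x / y - w / v| ≤ 4 * η * |w / v| := by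
  have h1 : 1 / 2 ≤ y * w := by linarith [(abs_le.1 hy).1]
  have hy0 : 0 < y := pos_of_mul_pos_left (by linarith) hw.le
  have h2 : |x * v - y * w| ≤ 2 * η := by
    have := abs_sub (x * v - 1) (y * w - 1)
    rw [sub_sub_sub_cancel_right] at this
    linarith
  have h3 : x / y - w / v = (x * v - y * w) / (y * w) * (w / v) := by
    field_simp
  rw [h3, abs_mul]
  refine mul_le_mul_of_nonneg_right ?_ (abs_nonneg _)
  rw [abs_div, abs_of_pos (by positivity : 0 < y * w), div_le_iff₀ (by positivity)]
  have : 0 ≤ η := (abs_nonneg _).trans hx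
  nlinarith

lemma saddle_weight_div {p q B₀ B₁ : ℝ} (G₀ G₁ s : ℝ) (n : ℕ)
    (hq : 0 < q) (hB₀ : 0 < B₀) (hB₁ : 0 < B₁) :
    p ^ n * Real.exp (-(1 * G₀)) * √(2 * Real.pi * (1 * B₀)) /
        (q ^ n * Real.exp (-(Real.exp (-s) * G₁)) * √(2 * Real.pi * (Real.exp (-s) * B₁))) =
      Real.exp (s / 2) * (p / q) ^ n * (Real.exp (Real.exp (-s) * G₁) / Real.exp G₀) *
        √(B₀ / B₁) := by
  have hπ := Real.pi_pos
  have h0 : √(2 * Real.pi * (1 * B₀)) = √(2 * Real.pi) * √B₀ := by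
    rw [one_mul, Real.sqrt_mul (by positivity)]
  have h1 : √(2 * Real.pi * (Real.exp (-s) * B₁)) =
      √(2 * Real.pi) * ((Real.exp (s / 2))⁻¹ * √B₁) := by
    rw [Real.sqrt_mul (by positivity), Real.sqrt_mul (Real.exp_pos _).le, ← Real.exp_half,
      neg_div, Real.exp_neg]
  have : 0 < √B₁ := Real.sqrt_pos.2 hB₁
  rw [h0, h1, Real.sqrt_div hB₀.le, one_mul, Real.exp_neg, Real.exp_neg (_ * G₁), div_pow]
  field_simp

/-- **Corollary 3.1 (second part).** Let `s ∈ ℝ`, `g_θ` log-admissible with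
associated functions `a`, `b`, and `r_x` the unique solution of `a(r) = x`. Then
`𝔼[exp(-s K_{0n})] = e^{s/2} (r_n/r_{e^s n})^n
· exp(e^{-s} g_θ(r_{e^s n}))/exp(g_θ(r_n)) · (b(r_n)/b(r_{e^s n}))^{1/2}
(1 + o(1))` as `n → ∞`, uniformly in `s` for `s` in a fixed compact set. -/
theorem asymptotic_laplace_numCycles
    (θ : ℕ → ℝ) (hθ : ∀ j, 0 ≤ θ j) (ρ : ℝ) (a b δ : ℝ → ℝ)
    (hadm : IsLogAdmissible (gThetaC θ) (thetaCoeff θ) ρ a b δ)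
    (r : ℝ → ℝ) (hr : ∀ x > 0, r x ∈ Set.Ico 0 ρ ∧ a (r x) = x)
    (hru : ∀ x > 0, ∀ y ∈ Set.Ico (0 : ℝ) ρ, a y = x → y = r x) :
    ∀ M > 0, ∀ ε > 0, ∃ N : ℕ, ∀ n ≥ N, ∀ s : ℝ, |s| ≤ M →
      |ewensExpect θ n (fun σ => Real.exp (-s * (numCycles n σ : ℝ))) -
          Real.exp (s / 2) * (r n / r (Real.exp s * n)) ^ n *
            (Real.exp (Real.exp (-s) * gThetaR θ (r (Real.exp s * n))) /
              Real.exp (gThetaR θ (r n))) *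
            Real.sqrt (b (r n) / b (r (Real.exp s * n)))| ≤
        ε * |Real.exp (s / 2) * (r n / r (Real.exp s * n)) ^ n *
            (Real.exp (Real.exp (-s) * gThetaR θ (r (Real.exp s * n))) /
              Real.exp (gThetaR θ (r n))) *
            Real.sqrt (b (r n) / b (r (Real.exp s * n)))| := by
  intro M hM ε hε
  have hη : 0 < min (1 / 2) (ε / 4) := by positivity
  obtain ⟨x₀, hx₀⟩ := eventually_atTop.1 ((hadm.tendsto_saddle hr).eventually
    (eventually_abs_partitionSum_saddle_sub_one_le hadm M hη))
  obtain ⟨N, hN⟩ := exists_nat_gt (max 0 (max x₀ (Real.exp M * x₀)))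
  refine ⟨N, fun n hn s hs => ?_⟩
  obtain ⟨hs1, hs2⟩ := abs_le.1 hs
  have hnN : (N : ℝ) ≤ n := by exact_mod_cast hn
  obtain ⟨hn0, hn'⟩ := max_lt_iff.1 (hN.trans_le hnN)
  obtain ⟨hn1, hn2⟩ := max_lt_iff.1 hn'
  have hsn : x₀ ≤ Real.exp s * n := by
    calc x₀ = Real.exp (-M) * (Real.exp M * x₀) := by
          rw [← mul_assoc, ← Real.exp_add, neg_add_cancel, Real.exp_zero, one_mul]
      _ ≤ Real.exp (-M) * n := by gcongr
      _ ≤ Real.exp s * n := by gcongr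
  obtain ⟨hr₀, hb₀, h₀⟩ := hx₀ n hn1.le
  obtain ⟨hr₁, hb₁, h₁⟩ := hx₀ _ hsn
  have h₀' := h₀ 1 (Real.exp_le_one_iff.2 (by linarith)) (Real.one_le_exp hM.le) n
    (by rw [(hr n hn0).2, one_mul])
  have h₁' := h₁ (Real.exp (-s)) (Real.exp_le_exp.2 (by linarith))
    (Real.exp_le_exp.2 (by linarith)) n (by
      rw [(hr _ (mul_pos (Real.exp_pos s) hn0)).2, ← mul_assoc, ← Real.exp_add,
        neg_add_cancel, Real.exp_zero, one_mul])
  have hπ := Real.pi_pos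
  rw [ewensExpect_exp_neg_mul_numCycles, ← saddle_weight_div _ _ s n hr₁ hb₀ hb₁]
  refine (abs_div_sub_div_le (by positivity) (by positivity) (min_le_left _ _) h₁' h₀').trans
    (mul_le_mul_of_nonneg_right ?_ (abs_nonneg _))
  linarith [min_le_right (1 / 2) (ε / 4)]
end
end

section
/- Let the weights be θ_k = k, so that g_θ(t) = (1 − t)^{−1}. Then the Laplace transform of the total cycle count under the generalized Ewens measure satisfies 𝔼[exp(−s K_{0n})] = e^{−s/4} exp(2√n (e^{−s/2} − 1)(1 + o(1))) as n → ∞, where the error is uniform in s for s in any fixed compact set. -/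
open Filter Set Asymptotics MeasureTheory
open scoped Topology

noncomputable section

/-- `(1 / n!) ∑ w(σ)` over the permutations with `m + 1` cycles, for the weights `θ_k = k`. -/
def lahCoeff (n m : ℕ) : ℝ := ((n - 1).choose m : ℝ) / ((m + 1).factorial : ℝ)

lemma lahCoeff_nonneg (n m : ℕ) : 0 ≤ lahCoeff n m := by unfold lahCoeff; positivity

lemma lahCoeff_succ {n : ℕ} (hn : 1 ≤ n) (m : ℕ) :
    ((m : ℝ) + 2) * (m + 1) * lahCoeff n (m + 1) = (n - 1 - m) * lahCoeff n m := by
  obtain ⟨N, rfl⟩ : ∃ N, n = N + 1 := ⟨n - 1, by omega⟩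
  have h : (N.choose (m + 1) : ℝ) * (m + 1) = N.choose m * ((N : ℝ) - m) := by
    rcases le_or_gt m N with h | h
    · have := Nat.choose_succ_right_eq N m
      rw [← Nat.cast_sub h]
      exact_mod_cast this
    · simp [Nat.choose_eq_zero_of_lt h, Nat.choose_eq_zero_of_lt (h.trans (Nat.lt_succ_self m))]
  have hf : ((m + 1).factorial : ℝ) ≠ 0 := by positivity
  simp only [lahCoeff, Nat.add_sub_cancel, Nat.factorial_succ (m + 1)]
  push_cast
  field_simp
  linear_combination ((m : ℝ) + 2) * h

/-- The moment generating function of the cycle count, up to normalization. -/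
def lahSum (n : ℕ) (x : ℝ) : ℝ :=
  ∑ m ∈ Finset.range n, lahCoeff n m * Real.exp (((m : ℝ) + 1) * x)

/-- The derivative of `lahSum n`. -/
def lahSumDeriv (n : ℕ) (x : ℝ) : ℝ :=
  ∑ m ∈ Finset.range n, ((m : ℝ) + 1) * (lahCoeff n m * Real.exp (((m : ℝ) + 1) * x))

lemma hasDerivAt_lahSum (n : ℕ) (x : ℝ) : HasDerivAt (lahSum n) (lahSumDeriv n x) x := by
  unfold lahSum lahSumDeriv
  refine HasDerivAt.fun_sum fun m _ => ?_
  have h := (((hasDerivAt_id x).const_mul ((m : ℝ) + 1)).exp).const_mul (lahCoeff n m)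
  refine h.congr_deriv ?_
  simp only [id]
  ring

lemma lahSum_pos {n : ℕ} (hn : 1 ≤ n) (x : ℝ) : 0 < lahSum n x := by
  refine Finset.sum_pos' (fun m _ => mul_nonneg (lahCoeff_nonneg n m) (Real.exp_pos _).le)
    ⟨0, Finset.mem_range.mpr hn, ?_⟩
  simp only [lahCoeff, Nat.choose_zero_right]
  positivity

lemma lahSum_le_lahSumDeriv (n : ℕ) (x : ℝ) : lahSum n x ≤ lahSumDeriv n x := by
  refine Finset.sum_le_sum fun m _ => ?_
  have := mul_nonneg (lahCoeff_nonneg n m) (Real.exp_pos (((m : ℝ) + 1) * x)).le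
  have hm : (0 : ℝ) ≤ m := m.cast_nonneg
  nlinarith

/-- Summation against a test function, from the term ratio of `lahCoeff`. -/
lemma sum_lahCoeff_shift {n : ℕ} (hn : 1 ≤ n) (x : ℝ) (f : ℕ → ℝ) :
    ∑ m ∈ Finset.range n,
        ((m : ℝ) + 1) * m * f m * (lahCoeff n m * Real.exp (((m : ℝ) + 1) * x)) =
      Real.exp x * ∑ m ∈ Finset.range n,
        ((n : ℝ) - 1 - m) * f (m + 1) * (lahCoeff n m * Real.exp (((m : ℝ) + 1) * x)) := by
  obtain ⟨N, rfl⟩ : ∃ N, n = N + 1 := ⟨n - 1, by omega⟩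
  rw [Finset.sum_range_succ', Finset.sum_range_succ]
  push_cast
  simp only [mul_zero, zero_mul, add_zero, add_sub_cancel_right, sub_self, Finset.mul_sum]
  refine Finset.sum_congr rfl fun m _ => ?_
  have h := lahCoeff_succ hn m
  push_cast at h
  have he : Real.exp (((m : ℝ) + 1 + 1) * x) = Real.exp x * Real.exp (((m : ℝ) + 1) * x) := by
    rw [← Real.exp_add]; ring_nf
  rw [he]
  linear_combination f (m + 1) * Real.exp x * Real.exp (((m : ℝ) + 1) * x) * h

lemma sq_lahSumDeriv_le {n : ℕ} (hn : 1 ≤ n) (x : ℝ) :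
    lahSumDeriv n x ^ 2 ≤
      lahSum n x * (Real.exp x * n * lahSum n x + (1 - Real.exp x) * lahSumDeriv n x) := by
  have hcs := Finset.sum_sq_le_sum_mul_sum_of_sq_le_mul (Finset.range n)
    (r := fun m => ((m : ℝ) + 1) * (lahCoeff n m * Real.exp (((m : ℝ) + 1) * x)))
    (f := fun m => lahCoeff n m * Real.exp (((m : ℝ) + 1) * x))
    (g := fun m => ((m : ℝ) + 1) ^ 2 * (lahCoeff n m * Real.exp (((m : ℝ) + 1) * x)))
    (fun m _ => mul_nonneg (lahCoeff_nonneg n m) (Real.exp_pos _).le)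
    (fun m _ => mul_nonneg (by positivity)
      (mul_nonneg (lahCoeff_nonneg n m) (Real.exp_pos _).le))
    (fun m _ => le_of_eq (by ring))
  have hs := sum_lahCoeff_shift hn x (fun _ => 1)
  have h1 : ∑ m ∈ Finset.range n, ((m : ℝ) + 1) ^ 2 *
        (lahCoeff n m * Real.exp (((m : ℝ) + 1) * x)) =
      Real.exp x * n * lahSum n x + (1 - Real.exp x) * lahSumDeriv n x := by
    have e1 : ∑ m ∈ Finset.range n, ((m : ℝ) + 1) ^ 2 *
        (lahCoeff n m * Real.exp (((m : ℝ) + 1) * x)) = (∑ m ∈ Finset.range n,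
        ((m : ℝ) + 1) * m * 1 * (lahCoeff n m * Real.exp (((m : ℝ) + 1) * x)))
          + lahSumDeriv n x := by
      rw [lahSumDeriv, ← Finset.sum_add_distrib]
      exact Finset.sum_congr rfl fun m _ => by ring
    have e2 : ∑ m ∈ Finset.range n,
        ((n : ℝ) - 1 - m) * 1 * (lahCoeff n m * Real.exp (((m : ℝ) + 1) * x)) =
        n * lahSum n x - lahSumDeriv n x := by
      rw [lahSumDeriv, lahSum, Finset.mul_sum, ← Finset.sum_sub_distrib]
      exact Finset.sum_congr rfl fun m _ => by ring
    rw [e1, hs, e2]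
    ring
  rw [h1] at hcs
  exact hcs

lemma le_lahSumDeriv_mul {n : ℕ} (hn : 1 ≤ n) (x : ℝ) :
    Real.exp x * (n + 1) * lahSum n x ^ 2 ≤
      (lahSumDeriv n x + lahSum n x) *
        (lahSumDeriv n x + (Real.exp x - 1) * lahSum n x) := by
  have hcs := Finset.sum_sq_le_sum_mul_sum_of_sq_le_mul (Finset.range n)
    (r := fun m => lahCoeff n m * Real.exp (((m : ℝ) + 1) * x))
    (f := fun m => ((m : ℝ) + 2) * (lahCoeff n m * Real.exp (((m : ℝ) + 1) * x)))
    (g := fun m => 1 / ((m : ℝ) + 2) * (lahCoeff n m * Real.exp (((m : ℝ) + 1) * x)))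
    (fun m _ => mul_nonneg (by positivity)
      (mul_nonneg (lahCoeff_nonneg n m) (Real.exp_pos _).le))
    (fun m _ => mul_nonneg (by positivity)
      (mul_nonneg (lahCoeff_nonneg n m) (Real.exp_pos _).le))
    (fun m _ => le_of_eq (by field_simp))
  have hs := sum_lahCoeff_shift hn x (fun m => 1 / ((m : ℝ) + 1))
  set R := ∑ m ∈ Finset.range n,
    1 / ((m : ℝ) + 2) * (lahCoeff n m * Real.exp (((m : ℝ) + 1) * x)) with hR
  have e1 : ∑ m ∈ Finset.range n, ((m : ℝ) + 2) *
      (lahCoeff n m * Real.exp (((m : ℝ) + 1) * x)) = lahSumDeriv n x + lahSum n x := by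
    rw [lahSumDeriv, lahSum, ← Finset.sum_add_distrib]
    exact Finset.sum_congr rfl fun m _ => by ring
  have e2 : ∑ m ∈ Finset.range n,
      ((m : ℝ) + 1) * m * (1 / ((m : ℝ) + 1)) *
        (lahCoeff n m * Real.exp (((m : ℝ) + 1) * x)) = lahSumDeriv n x - lahSum n x := by
    rw [lahSumDeriv, lahSum, ← Finset.sum_sub_distrib]
    exact Finset.sum_congr rfl fun m _ => by field_simp; ring
  have e3 : ∑ m ∈ Finset.range n,
      ((n : ℝ) - 1 - m) * (1 / (((m + 1 : ℕ) : ℝ) + 1)) *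
        (lahCoeff n m * Real.exp (((m : ℝ) + 1) * x)) = (n + 1) * R - lahSum n x := by
    rw [hR, lahSum, Finset.mul_sum, ← Finset.sum_sub_distrib]
    refine Finset.sum_congr rfl fun m _ => ?_
    push_cast
    have : (m : ℝ) + 2 ≠ 0 := by positivity
    rw [show (m : ℝ) + 1 + 1 = m + 2 by ring]
    field_simp
    ring
  rw [e2, e3] at hs
  rw [e1] at hcs
  have hc : lahSum n x ^ 2 ≤ (lahSumDeriv n x + lahSum n x) * R := hcs
  have := mul_le_mul_of_nonneg_left hc (show 0 ≤ Real.exp x * ((n : ℝ) + 1) by positivity)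
  linear_combination this - (lahSumDeriv n x + lahSum n x) * hs

/-- The mean of the tilted cycle count is `√(n e^x) + O(1)`. -/
lemma abs_lahSumDeriv_div_sub_le {n : ℕ} (hn : 1 ≤ n) (x : ℝ) :
    |lahSumDeriv n x / lahSum n x - Real.sqrt n * Real.exp (x / 2)| ≤ 1 + Real.exp x := by
  have hZ := lahSum_pos hn x
  set μ := lahSumDeriv n x / lahSum n x with hμ
  have hD : lahSumDeriv n x = μ * lahSum n x := by rw [hμ]; field_simp
  have h1 : 1 ≤ μ := by rw [hμ, le_div_iff₀ hZ, one_mul]; exact lahSum_le_lahSumDeriv n x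
  set r := Real.sqrt n * Real.exp (x / 2) with hr
  have hu := Real.exp_pos x
  have hr0 : 0 ≤ r := by positivity
  have hr2 : r ^ 2 = Real.exp x * n := by
    rw [hr, mul_pow, Real.sq_sqrt n.cast_nonneg, ← Real.exp_nat_mul, mul_comm]
    congr 2
    push_cast
    ring
  have hup : μ ^ 2 ≤ r ^ 2 + (1 - Real.exp x) * μ := by
    have h := sq_lahSumDeriv_le hn x
    rw [hD] at h
    have : lahSum n x ^ 2 * μ ^ 2 ≤ lahSum n x ^ 2 * (r ^ 2 + (1 - Real.exp x) * μ) := by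
      rw [hr2]; linarith
    exact le_of_mul_le_mul_left this (by positivity)
  have hlo : r ^ 2 + Real.exp x ≤ (μ + 1) * (μ + (Real.exp x - 1)) := by
    have h := le_lahSumDeriv_mul hn x
    rw [hD] at h
    have : lahSum n x ^ 2 * (r ^ 2 + Real.exp x) ≤
        lahSum n x ^ 2 * ((μ + 1) * (μ + (Real.exp x - 1))) := by
      rw [hr2]; linarith
    exact le_of_mul_le_mul_left this (by positivity)
  rw [abs_le]
  constructor
  · by_contra! h
    nlinarith
  · by_contra! h
    nlinarith

lemma abs_log_lahSum_sub_le {n : ℕ} (hn : 1 ≤ n) {M x : ℝ} (hx : |x| ≤ M) :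
    |Real.log (lahSum n x / lahSum n 0) - 2 * Real.sqrt n * (Real.exp (x / 2) - 1)| ≤
      (1 + Real.exp M) * |x| := by
  have hd : ∀ y ∈ Set.Icc (-M) M, HasDerivWithinAt
      (fun y => Real.log (lahSum n y) - 2 * Real.sqrt n * Real.exp (y / 2))
      (lahSumDeriv n y / lahSum n y - Real.sqrt n * Real.exp (y / 2)) (Set.Icc (-M) M) y := by
    intro y _
    have h1 := (hasDerivAt_lahSum n y).log (lahSum_pos hn y).ne'
    have h2 := (((hasDerivAt_id y).div_const 2).exp).const_mul (2 * Real.sqrt n)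
    refine ((h1.sub h2).congr_deriv ?_).hasDerivWithinAt
    simp only [id]
    ring
  have hb : ∀ y ∈ Set.Icc (-M) M,
      ‖lahSumDeriv n y / lahSum n y - Real.sqrt n * Real.exp (y / 2)‖ ≤ 1 + Real.exp M := by
    intro y hy
    refine (abs_lahSumDeriv_div_sub_le hn y).trans ?_
    gcongr
    exact hy.2
  have hM : 0 ≤ M := (abs_nonneg x).trans hx
  have h := (convex_Icc (-M) M).norm_image_sub_le_of_norm_hasDerivWithin_le hd hb
    (x := 0) (y := x) ⟨by linarith, hM⟩ (abs_le.mp hx)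
  rw [Real.log_div (lahSum_pos hn x).ne' (lahSum_pos hn 0).ne']
  simp only [Real.norm_eq_abs, zero_div, Real.exp_zero, sub_zero] at h
  convert h using 2
  ring

lemma abs_mul_exp_neg_le_abs_exp_sub_one {y B : ℝ} (hy : |y| ≤ B) :
    |y| * Real.exp (-B) ≤ |Real.exp y - 1| := by
  have hB : 0 ≤ B := (abs_nonneg y).trans hy
  have hB1 : Real.exp (-B) ≤ 1 := Real.exp_le_one_iff.mpr (by linarith)
  rcases le_total 0 y with h | h
  · rw [abs_of_nonneg h, abs_of_nonneg (by linarith [Real.one_le_exp h])]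
    nlinarith [Real.add_one_le_exp y]
  · rw [abs_of_nonpos h] at hy ⊢
    rw [abs_of_nonpos (by linarith [Real.exp_le_one_iff.mpr h])]
    have h1 : Real.exp (-B) ≤ Real.exp y := Real.exp_le_exp.mpr (by linarith)
    have h2 := Real.add_one_le_exp (-y)
    have h3 : Real.exp (-y) * Real.exp y = 1 := by rw [← Real.exp_add]; simp
    nlinarith [Real.exp_pos y]

/-- The multiset of all cycle lengths of `σ`, fixed points included. -/
def cycleLengths (n : ℕ) (σ : Equiv.Perm (Fin n)) : Multiset ℕ :=
  σ.cycleType + Multiset.replicate (n - σ.support.card) 1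

lemma sum_cycleLengths {n : ℕ} (σ : Equiv.Perm (Fin n)) : (cycleLengths n σ).sum = n := by
  have := σ.support.card_le_univ
  simp only [Fintype.card_fin] at this
  simp only [cycleLengths, Multiset.sum_add, Equiv.Perm.sum_cycleType, Multiset.sum_replicate,
    smul_eq_mul, mul_one]
  omega

lemma card_cycleLengths {n : ℕ} (σ : Equiv.Perm (Fin n)) :
    (cycleLengths n σ).card = numCycles n σ := by
  simp [cycleLengths, numCycles, add_comm]

lemma one_le_of_mem_cycleLengths {n : ℕ} {σ : Equiv.Perm (Fin n)} {a : ℕ}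
    (ha : a ∈ cycleLengths n σ) : 1 ≤ a := by
  rcases Multiset.mem_add.mp ha with h | h
  · exact (Equiv.Perm.two_le_of_mem_cycleType h).trans' one_le_two
  · exact (Multiset.eq_of_mem_replicate h).ge

lemma count_cycleLengths {n : ℕ} (σ : Equiv.Perm (Fin n)) (j : ℕ) :
    (cycleLengths n σ).count j = cycleCount n j σ := by
  rw [cycleLengths, Multiset.count_add, Multiset.count_replicate, cycleCount]
  by_cases hj : j = 1
  · subst hj
    have : σ.cycleType.count 1 = 0 := Multiset.count_eq_zero.mpr fun h =>
      absurd (Equiv.Perm.two_le_of_mem_cycleType h) (by norm_num)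
    simp [this]
  · simp [hj, Ne.symm hj]

lemma cycleLengths_mem_Icc {n : ℕ} {σ : Equiv.Perm (Fin n)} {a : ℕ}
    (ha : a ∈ cycleLengths n σ) : a ∈ Finset.Icc 1 n :=
  Finset.mem_Icc.mpr ⟨one_le_of_mem_cycleLengths ha,
    (Multiset.le_sum_of_mem ha).trans_eq (sum_cycleLengths σ)⟩

lemma ewensWeight_natCast {n : ℕ} (σ : Equiv.Perm (Fin n)) :
    ewensWeight (fun k => (k : ℝ)) n σ = ((cycleLengths n σ).prod : ℝ) := by
  rw [Finset.prod_multiset_count_of_subset (cycleLengths n σ) (Finset.Icc 1 n)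
    fun a ha => cycleLengths_mem_Icc (Multiset.mem_toFinset.mp ha)]
  simp [ewensWeight, count_cycleLengths]

lemma filter_two_le_add_replicate {q : Multiset ℕ} (hq1 : ∀ a ∈ q, 1 ≤ a) :
    q.filter (2 ≤ ·) + Multiset.replicate (q.count 1) 1 = q := by
  ext a
  rw [Multiset.count_add, Multiset.count_filter, Multiset.count_replicate]
  by_cases ha : a ∈ q
  · have := hq1 a ha
    rcases this.eq_or_lt with h | h
    · simp [← h]
    · have h2 : 2 ≤ a := h
      simp [h2, h.ne]
  · have h0 := Multiset.count_eq_zero.mpr ha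
    rw [h0]
    by_cases h1 : 1 = a
    · simp [h1, h0]
    · simp [h1]

lemma sum_filter_two_le_add_count {q : Multiset ℕ} (hq1 : ∀ a ∈ q, 1 ≤ a) :
    (q.filter (2 ≤ ·)).sum + q.count 1 = q.sum := by
  conv_rhs => rw [← filter_two_le_add_replicate hq1]
  simp

/-- `cycleLengths n σ` is determined by the cycle type, its part above `1`. -/
lemma cycleLengths_eq_iff {n : ℕ} {q : Multiset ℕ} (hq : q.sum = n) (hq1 : ∀ a ∈ q, 1 ≤ a)
    (σ : Equiv.Perm (Fin n)) :
    cycleLengths n σ = q ↔ σ.cycleType = q.filter (2 ≤ ·) := by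
  have hsum := sum_filter_two_le_add_count hq1
  constructor
  · rintro rfl
    rw [cycleLengths, Multiset.filter_add,
      Multiset.filter_eq_self.mpr fun a ha => Equiv.Perm.two_le_of_mem_cycleType ha,
      Multiset.filter_eq_nil.mpr fun a ha => ?_, add_zero]
    rw [Multiset.eq_of_mem_replicate ha]
    norm_num
  · intro h
    rw [cycleLengths, ← Equiv.Perm.sum_cycleType, h]
    conv_rhs => rw [← filter_two_le_add_replicate hq1]
    congr 2
    omega

lemma prod_factorial_count_mul_countPerms (q : Multiset ℕ) :
    (∏ i ∈ q.toFinset, (q.count i).factorial) * q.countPerms = q.card.factorial := by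
  have h := Nat.multinomial_spec q.toFinset (fun i => q.count i)
  rw [Multiset.toFinset_sum_count_eq] at h
  exact h

lemma card_cycleLengths_eq_mul {n : ℕ} {q : Multiset ℕ} (hq : q.sum = n)
    (hq1 : ∀ a ∈ q, 1 ≤ a) :
    (Finset.univ.filter fun σ : Equiv.Perm (Fin n) => cycleLengths n σ = q).card * q.prod *
      q.card.factorial = n.factorial * q.countPerms := by
  have hsum := sum_filter_two_le_add_count hq1
  have hcard := Equiv.Perm.card_of_cycleType_mul_eq (Fin n) (q.filter (2 ≤ ·))
  rw [Fintype.card_fin, if_pos ⟨by omega, fun a ha => (Multiset.mem_filter.mp ha).2⟩,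
    show n - (q.filter (2 ≤ ·)).sum = q.count 1 by omega] at hcard
  have hprod : (q.filter (2 ≤ ·)).prod = q.prod := by
    conv_rhs => rw [← filter_two_le_add_replicate hq1]
    simp
  have hfact : (q.count 1).factorial *
      ∏ i ∈ (q.filter (2 ≤ ·)).toFinset, ((q.filter (2 ≤ ·)).count i).factorial =
        ∏ i ∈ q.toFinset, (q.count i).factorial := by
    have h1 : 1 ∉ (q.filter (2 ≤ ·)).toFinset := by simp
    have h2 : ∏ i ∈ (q.filter (2 ≤ ·)).toFinset, ((q.filter (2 ≤ ·)).count i).factorial =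
        ∏ i ∈ (q.filter (2 ≤ ·)).toFinset, (q.count i).factorial := by
      refine Finset.prod_congr rfl fun i hi => ?_
      rw [Multiset.count_filter_of_pos]
      exact (Multiset.mem_filter.mp (Multiset.mem_toFinset.mp hi)).2
    rw [h2, ← Finset.prod_insert (f := fun i => (q.count i).factorial) h1]
    symm
    refine Finset.prod_subset (fun i hi => ?_) fun i _ hi => ?_
    · have hi' := Multiset.mem_toFinset.mp hi
      rcases (hq1 i hi').eq_or_lt with h | h
      · exact Finset.mem_insert.mpr (Or.inl h.symm)
      · exact Finset.mem_insert_of_mem (Multiset.mem_toFinset.mpr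
          (Multiset.mem_filter.mpr ⟨hi', h⟩))
    · rw [Multiset.count_eq_zero.mpr fun h => hi (Multiset.mem_toFinset.mpr h),
        Nat.factorial_zero]
  simp only [cycleLengths_eq_iff hq hq1]
  rw [← prod_factorial_count_mul_countPerms q, ← hfact, ← hcard, hprod]
  ring

lemma sum_countPerms (n m : ℕ) :
    ∑ q ∈ (Finset.Icc 1 n).sym m with q.val.sum = n, (q.val.countPerms : ℝ) =
      PowerSeries.coeff n ((PowerSeries.X * PowerSeries.mk 1 : PowerSeries ℝ) ^ m) := by
  have htr : ((PowerSeries.trunc (n + 1) (PowerSeries.X * PowerSeries.mk 1 : PowerSeries ℝ) :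
      Polynomial ℝ)) = ∑ i ∈ Finset.Icc 1 n, Polynomial.X ^ i := by
    ext k
    rw [PowerSeries.coeff_trunc, Polynomial.finsetSum_coeff]
    simp only [Polynomial.coeff_X_pow]
    rw [Finset.sum_ite_eq]
    cases k with
    | zero => simp
    | succ k => simp [PowerSeries.coeff_succ_X_mul]
  rw [← PowerSeries.coeff_coe_trunc_of_lt (Nat.lt_succ_self n), ← PowerSeries.trunc_trunc_pow,
    PowerSeries.coeff_coe_trunc_of_lt (Nat.lt_succ_self n), htr, ← Polynomial.coe_pow,
    Polynomial.coeff_coe, Finset.sum_pow, Polynomial.finsetSum_coeff, Finset.sum_filter]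
  refine Finset.sum_congr rfl fun q _ => ?_
  have : (q.val.map fun i => (Polynomial.X : Polynomial ℝ) ^ i).prod =
      Polynomial.X ^ q.val.sum := by
    induction q.val using Multiset.induction_on with
    | empty => simp
    | cons a s ih => simp [ih, pow_add]
  rw [this, ← Polynomial.C_eq_natCast, Polynomial.coeff_C_mul, Polynomial.coeff_X_pow]
  simp only [mul_ite, mul_one, mul_zero, eq_comm (a := n)]

lemma coeff_X_mul_mk_one_pow_succ {n : ℕ} (hn : 1 ≤ n) (m : ℕ) :
    PowerSeries.coeff n ((PowerSeries.X * PowerSeries.mk 1 : PowerSeries ℝ) ^ (m + 1)) =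
      (n - 1).choose m := by
  rw [mul_pow, PowerSeries.coeff_X_pow_mul', PowerSeries.mk_one_pow_eq_mk_choose_add]
  split_ifs with h
  · rw [PowerSeries.coeff_mk]
    congr 2
    omega
  · rw [Nat.choose_eq_zero_of_lt (by omega), Nat.cast_zero]

lemma sum_prod_cycleLengths (n m : ℕ) :
    (∑ σ : Equiv.Perm (Fin n) with numCycles n σ = m, (cycleLengths n σ).prod) * m.factorial =
      n.factorial * ∑ q ∈ (Finset.Icc 1 n).sym m with q.val.sum = n, q.val.countPerms := by
  set T := ((Finset.Icc 1 n).sym m).filter fun q => q.val.sum = n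
  have hmaps : ∀ σ ∈ Finset.univ.filter fun σ : Equiv.Perm (Fin n) => numCycles n σ = m,
      cycleLengths n σ ∈ T.map (⟨fun q => q.val, Sym.coe_injective⟩ : Sym ℕ m ↪ Multiset ℕ) := by
    intro σ hσ
    rw [Finset.mem_map]
    refine ⟨⟨cycleLengths n σ, (card_cycleLengths σ).trans (Finset.mem_filter.mp hσ).2⟩, ?_, rfl⟩
    exact Finset.mem_filter.mpr ⟨Finset.mem_sym_iff.mpr fun a ha => cycleLengths_mem_Icc ha,
      sum_cycleLengths σ⟩
  rw [← Finset.sum_fiberwise_of_maps_to hmaps, Finset.sum_map, Finset.sum_mul, Finset.mul_sum]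
  refine Finset.sum_congr rfl fun q hq => ?_
  obtain ⟨hq1, hqn⟩ := Finset.mem_filter.mp hq
  rw [← card_cycleLengths_eq_mul hqn fun a ha =>
    (Finset.mem_Icc.mp (Finset.mem_sym_iff.mp hq1 a ha)).1]
  have hfil : (Finset.univ.filter fun σ : Equiv.Perm (Fin n) => numCycles n σ = m).filter
      (fun σ => cycleLengths n σ = q.val) =
        Finset.univ.filter fun σ : Equiv.Perm (Fin n) => cycleLengths n σ = q.val := by
    rw [Finset.filter_filter]
    refine Finset.filter_congr fun σ _ => ⟨fun h => h.2, fun h => ⟨?_, h⟩⟩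
    rw [← card_cycleLengths, h]
    exact q.2
  have hcard : q.val.card = m := q.2
  change (∑ σ ∈ (Finset.univ.filter fun σ : Equiv.Perm (Fin n) => numCycles n σ = m).filter
    (fun σ => cycleLengths n σ = q.val), (cycleLengths n σ).prod) * _ = _
  rw [hfil, hcard, Finset.sum_congr rfl fun σ hσ =>
    congrArg Multiset.prod (Finset.mem_filter.mp hσ).2, Finset.sum_const, smul_eq_mul]

lemma numCycles_mem_Icc {n : ℕ} (hn : 1 ≤ n) (σ : Equiv.Perm (Fin n)) :
    numCycles n σ ∈ Finset.Icc 1 n := by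
  rw [← card_cycleLengths, Finset.mem_Icc]
  constructor
  · rw [Nat.one_le_iff_ne_zero, Ne, Multiset.card_eq_zero]
    intro h
    have := sum_cycleLengths σ
    rw [h, Multiset.sum_zero] at this
    omega
  · have := Multiset.card_nsmul_le_sum fun a (ha : a ∈ cycleLengths n σ) =>
      one_le_of_mem_cycleLengths ha
    rwa [sum_cycleLengths, smul_eq_mul, mul_one] at this

lemma sum_ewensWeight_numCycles_eq {n : ℕ} (hn : 1 ≤ n) (m : ℕ) :
    ∑ σ : Equiv.Perm (Fin n) with numCycles n σ = m + 1, ewensWeight (fun k => (k : ℝ)) n σ =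
      n.factorial * lahCoeff n m := by
  have h := congrArg (Nat.cast : ℕ → ℝ) (sum_prod_cycleLengths n (m + 1))
  simp only [Nat.cast_mul, Nat.cast_sum] at h
  rw [sum_countPerms, coeff_X_mul_mk_one_pow_succ hn] at h
  simp only [ewensWeight_natCast, lahCoeff]
  rw [mul_div_assoc', eq_div_iff (by positivity)]
  exact h

lemma sum_exp_mul_ewensWeight {n : ℕ} (hn : 1 ≤ n) (x : ℝ) :
    ∑ σ : Equiv.Perm (Fin n),
        Real.exp (x * (numCycles n σ : ℝ)) * ewensWeight (fun k => (k : ℝ)) n σ =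
      n.factorial * lahSum n x := by
  rw [← Finset.sum_fiberwise_of_maps_to fun σ _ => numCycles_mem_Icc hn σ,
    ← Finset.Ico_add_one_right_eq_Icc, Finset.sum_Ico_eq_sum_range, lahSum, Finset.mul_sum]
  refine Finset.sum_congr rfl fun m _ => ?_
  rw [add_comm 1 m, ← mul_assoc, ← sum_ewensWeight_numCycles_eq hn m, Finset.sum_mul]
  refine Finset.sum_congr rfl fun σ hσ => ?_
  rw [(Finset.mem_filter.mp hσ).2]
  push_cast
  ring_nf

lemma ewensExpect_exp_numCycles {n : ℕ} (hn : 1 ≤ n) (s : ℝ) :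
    ewensExpect (fun k => (k : ℝ)) n (fun σ => Real.exp (-s * (numCycles n σ : ℝ))) =
      lahSum n (-s) / lahSum n 0 := by
  have h0 := sum_exp_mul_ewensWeight hn 0
  simp only [zero_mul, Real.exp_zero, one_mul] at h0
  rw [ewensExpect, sum_exp_mul_ewensWeight hn, h0, mul_div_mul_left _ _ (by positivity)]

/-- **Proposition 3.2 (second part).** For `θ_k = k` (so `g_θ(t) = (1-t)^{-1}`
up to the constant term) one has
`𝔼[exp(-s K_{0n})] = e^{-s/4} exp(2√n (e^{-s/2} - 1)(1 + o(1)))` where the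
error is uniform in `s` for `s` in a fixed compact set. -/
theorem asymptotic_laplace_simple (M : ℝ) (hM : 0 < M) :
    ∃ err : ℕ → ℝ → ℝ,
      (∀ ε > 0, ∃ N : ℕ, ∀ n ≥ N, ∀ s : ℝ, |s| ≤ M → |err n s| ≤ ε) ∧
      ∀ n : ℕ, 1 ≤ n → ∀ s : ℝ, |s| ≤ M →
        ewensExpect (fun k => (k : ℝ)) n
            (fun σ => Real.exp (-s * (numCycles n σ : ℝ))) =
          Real.exp (-s / 4) *
            Real.exp (2 * Real.sqrt n * (Real.exp (-s / 2) - 1) * (1 + err n s)) := by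
  set err : ℕ → ℝ → ℝ := fun n s =>
    if s = 0 then 0 else
      (Real.log (lahSum n (-s) / lahSum n 0) + s / 4) /
        (2 * Real.sqrt n * (Real.exp (-s / 2) - 1)) - 1 with herr
  have hden : ∀ n : ℕ, 1 ≤ n → ∀ s : ℝ, s ≠ 0 →
      2 * Real.sqrt n * (Real.exp (-s / 2) - 1) ≠ 0 := by
    intro n hn s hs
    have hn' : (0 : ℝ) < n := by exact_mod_cast hn
    refine mul_ne_zero (by positivity) (sub_ne_zero.mpr fun h => hs ?_)
    have := (Real.exp_eq_one_iff _).mp h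
    linarith
  have hbound : ∀ n : ℕ, 1 ≤ n → ∀ s : ℝ, |s| ≤ M →
      |err n s| * Real.sqrt n ≤ (2 + Real.exp M) * Real.exp M := by
    intro n hn s hs
    by_cases hs0 : s = 0
    · simp only [herr, if_pos hs0, abs_zero, zero_mul]
      positivity
    have hd := hden n hn s hs0
    have hn' : (0 : ℝ) < n := by exact_mod_cast hn
    have hsq : 0 < Real.sqrt n := Real.sqrt_pos.mpr hn'
    have hs' : 0 < |s| := abs_pos.mpr hs0
    have hlog := abs_log_lahSum_sub_le hn (M := M) (x := -s) (by rwa [abs_neg])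
    rw [abs_neg] at hlog
    have hnum : |Real.log (lahSum n (-s) / lahSum n 0) + s / 4 -
        2 * Real.sqrt n * (Real.exp (-s / 2) - 1)| ≤ (2 + Real.exp M) * |s| := by
      have h4 : |s / 4| ≤ |s| := by
        rw [abs_div, abs_of_pos (by norm_num : (0 : ℝ) < 4)]
        linarith
      rw [add_sub_right_comm]
      refine (abs_add_le _ _).trans ?_
      linarith
    have hlow := abs_mul_exp_neg_le_abs_exp_sub_one (y := -s / 2) (B := M) (by
      rw [abs_div, abs_neg, abs_of_pos (by norm_num : (0 : ℝ) < 2)]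
      linarith)
    rw [abs_div, abs_neg, abs_of_pos (by norm_num : (0 : ℝ) < 2)] at hlow
    have hdabs : |2 * Real.sqrt n * (Real.exp (-s / 2) - 1)| =
        2 * Real.sqrt n * |Real.exp (-s / 2) - 1| := by
      rw [abs_mul, abs_of_pos (by positivity)]
    have he : Real.exp M * Real.exp (-M) = 1 := by rw [← Real.exp_add]; simp
    simp only [herr, if_neg hs0]
    rw [div_sub_one hd, abs_div, hdabs, div_mul_eq_mul_div, div_le_iff₀
      (hdabs ▸ abs_pos.mpr hd)]
    calc _ ≤ (2 + Real.exp M) * |s| * Real.sqrt n := by gcongr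
      _ = (2 + Real.exp M) * Real.exp M * (2 * Real.sqrt n * (|s| / 2 * Real.exp (-M))) := by
          linear_combination (-(2 + Real.exp M) * |s| * Real.sqrt n) * he
      _ ≤ _ := by gcongr
  refine ⟨err, fun ε hε => ?_, fun n hn s hs => ?_⟩
  · obtain ⟨N, hN⟩ := exists_nat_ge (((2 + Real.exp M) * Real.exp M / ε) ^ 2)
    refine ⟨N + 1, fun n hn s hs => ?_⟩
    have hn1 : 1 ≤ n := by omega
    have hsq : 0 < Real.sqrt n := Real.sqrt_pos.mpr (by exact_mod_cast hn1)
    have hle : (2 + Real.exp M) * Real.exp M / ε ≤ Real.sqrt n := by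
      refine Real.le_sqrt_of_sq_le (hN.trans ?_)
      exact_mod_cast (by omega : N ≤ n)
    rw [div_le_iff₀ hε, mul_comm (Real.sqrt n)] at hle
    exact le_of_mul_le_mul_right ((hbound n hn1 s hs).trans hle) hsq
  · rw [ewensExpect_exp_numCycles hn, ← Real.exp_add]
    by_cases hs0 : s = 0
    · simp [hs0, (lahSum_pos hn 0).ne']
    · have hd := hden n hn s hs0
      simp only [herr, if_neg hs0, add_sub_cancel, mul_div_cancel₀ _ hd]
      rw [show -s / 4 + (Real.log (lahSum n (-s) / lahSum n 0) + s / 4) =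
        Real.log (lahSum n (-s) / lahSum n 0) by ring,
        Real.exp_log (div_pos (lahSum_pos hn _) (lahSum_pos hn _))]
end
end
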